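/- arXiv:1308.3972 — 16 statements merged into one kernel-verified Lean document; each statement's English description precedes it below -/
import Mathlib

section
/- Let p, q > 1 be coprime integers. Then the semigroup polynomial of S(p,q) satisfies P_{S(p,q)}(x) = (1−x)·∑_{s∈S(p,q)} x^s = (x^{pq}−1)(x−1)/((x^p−1)(x^q−1)). -/
open Polynomial

/-- The Hilbert series of a set `S ⊆ ℕ`: the formal power series `∑_{s ∈ S} x^s`. -/
noncomputable def hilbertSeries (S : Set ℕ) : PowerSeries ℤ :=
  PowerSeries.mk fun n => Set.indicator S (fun _ => (1 : ℤ)) n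

lemma sg_excl (p q : ℕ) (hp : 1 < p) (hq : 1 < q) (hpq : Nat.Coprime p q) (a x y : ℕ)
    (ha : a < q) (h : p * a = x * p + y * q + q) : False := by
  have hxa : x ≤ a := by
    by_contra hc
    push Not at hc
    nlinarith
  obtain ⟨d, rfl⟩ := Nat.exists_eq_add_of_le hxa
  have h2 : p * d = q * (y + 1) := by nlinarith
  have h3 : q ∣ d := hpq.symm.dvd_of_dvd_mul_left ⟨y + 1, h2⟩
  rcases Nat.eq_zero_or_pos d with rfl | hd
  · nlinarith
  · have := Nat.le_of_dvd hd h3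
    omega

lemma sg_mem (p q : ℕ) (hp : 1 < p) (n : ℕ) :
    (∃ x y : ℕ, n = x * p + y * q) ↔
      ((∃ x y : ℕ, n = x * p + y * q + q) ∨ ∃ a < q, n = p * a) := by
  constructor
  · rintro ⟨x, y, rfl⟩
    rcases y with _ | y
    · rcases lt_or_ge x q with h | h
      · exact Or.inr ⟨x, h, by ring⟩
      · obtain ⟨d, rfl⟩ := Nat.exists_eq_add_of_le h
        obtain ⟨e, rfl⟩ := Nat.exists_eq_add_of_le hp.le
        exact Or.inl ⟨d, e, by ring⟩
    · exact Or.inl ⟨x, y, by ring⟩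
  · rintro (⟨x, y, rfl⟩ | ⟨a, -, rfl⟩)
    · exact ⟨x, y + 1, by ring⟩
    · exact ⟨a, 0, by ring⟩

lemma sg_large (p q : ℕ) (hp : 1 < p) (hq : 1 < q) (hpq : Nat.Coprime p q) (n : ℕ)
    (h : p * q ≤ n) : ∃ x y : ℕ, n = x * p + y * q := by
  by_contra hc
  have := (frobeniusNumber_pair hpq hp hq)
  rw [frobeniusNumber_iff] at this
  have h2 := this.2 n (by have := Nat.mul_pos (show 0 < p by omega) (show 0 < q by omega); omega)
  rw [AddSubmonoid.mem_closure_pair] at h2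
  obtain ⟨x, y, h⟩ := h2
  exact hc ⟨x, y, by simpa using h.symm⟩

lemma sg_key (p q : ℕ) (hp : 1 < p) (hq : 1 < q) (hpq : Nat.Coprime p q) :
    hilbertSeries {n | ∃ x y : ℕ, n = x * p + y * q} =
      PowerSeries.X ^ q * hilbertSeries {n | ∃ x y : ℕ, n = x * p + y * q} +
      ∑ a ∈ Finset.range q, (PowerSeries.X ^ p) ^ a := by
  classical
  ext n
  have hs : (∑ a ∈ Finset.range q, (if n = p * a then (1:ℤ) else 0)) =
      if ∃ a < q, n = p * a then 1 else 0 := by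
    split_ifs with h
    · obtain ⟨a, ha, rfl⟩ := h
      rw [Finset.sum_eq_single a]
      · simp
      · intro b _ hb
        rw [if_neg]
        intro h
        exact hb (Nat.eq_of_mul_eq_mul_left (by omega) h).symm
      · intro h
        simp at h
        omega
    · apply Finset.sum_eq_zero
      intro a ha
      rw [if_neg]
      intro h'
      exact h ⟨a, by simpa using ha, h'⟩
  have hsh : (if q ≤ n then (if ∃ x y : ℕ, n - q = x * p + y * q then (1:ℤ) else 0) else 0) =
      if ∃ x y : ℕ, n = x * p + y * q + q then 1 else 0 := by
    split_ifs with h1 h2 h3 h3 h3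
    · rfl
    · obtain ⟨x, y, h⟩ := h2
      exact absurd ⟨x, y, by omega⟩ h3
    · obtain ⟨x, y, h⟩ := h3
      exact absurd ⟨x, y, by omega⟩ h2
    · rfl
    · obtain ⟨x, y, h⟩ := h3
      omega
    · rfl
  simp only [map_add, map_sum, ← pow_mul, PowerSeries.coeff_X_pow, PowerSeries.coeff_X_pow_mul',
    hilbertSeries, PowerSeries.coeff_mk, Set.indicator_apply, Set.mem_ofPred_eq]
  rw [hs, hsh]
  have hm := sg_mem p q hp n
  by_cases h1 : ∃ x y : ℕ, n = x * p + y * q + q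
  · have h2 : ¬ ∃ a < q, n = p * a := by
      rintro ⟨a, ha, h⟩
      obtain ⟨x, y, h'⟩ := h1
      exact sg_excl p q hp hq hpq a x y ha (h ▸ h')
    rw [if_pos h1, if_neg h2, if_pos (hm.2 (Or.inl h1))]; rfl
  · by_cases h2 : ∃ a < q, n = p * a
    · rw [if_neg h1, if_pos h2, if_pos (hm.2 (Or.inr h2))]; rfl
    · rw [if_neg h1, if_neg h2, if_neg (fun h => (hm.1 h).elim h1 h2)]; rfl

theorem semigroup_polynomial_of_two_generators (p q : ℕ) (hp : 1 < p) (hq : 1 < q)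
    (hpq : Nat.Coprime p q) :
    ∃ P : Polynomial ℤ,
      (P : PowerSeries ℤ) =
        (1 - PowerSeries.X) * hilbertSeries {n | ∃ x y : ℕ, n = x * p + y * q} ∧
      P * ((Polynomial.X ^ p - 1) * (Polynomial.X ^ q - 1)) =
        (Polynomial.X ^ (p * q) - 1) * (Polynomial.X - 1) := by
  classical
  have hk := sg_key p q hp hq hpq
  have hl := sg_large p q hp hq hpq
  have hg := geom_sum_mul (PowerSeries.X ^ p : PowerSeries ℤ) q
  have hP : ((PowerSeries.trunc (p * q + 1) ((1 - PowerSeries.X) *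
      hilbertSeries {n | ∃ x y : ℕ, n = x * p + y * q}) : Polynomial ℤ) : PowerSeries ℤ) =
        (1 - PowerSeries.X) * hilbertSeries {n | ∃ x y : ℕ, n = x * p + y * q} := by
    ext n
    rw [Polynomial.coeff_coe, PowerSeries.coeff_trunc]
    split_ifs with h
    · rfl
    · obtain ⟨m, rfl⟩ : ∃ m, n = m + 1 := ⟨n - 1, by omega⟩
      rw [sub_mul, one_mul, map_sub, PowerSeries.coeff_succ_X_mul]
      simp only [hilbertSeries, PowerSeries.coeff_mk, Set.indicator_apply, Set.mem_ofPred_eq]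
      rw [if_pos (hl _ (by omega)), if_pos (hl _ (by omega))]
      rfl
  refine ⟨_, hP, ?_⟩
  apply Polynomial.coe_injective ℤ
  rw [Polynomial.coe_mul, hP]
  push_cast
  rw [pow_mul, ← hg]
  linear_combination (-(1 - PowerSeries.X) * (PowerSeries.X ^ p - 1)) * hk
end

section
/- If p and q are distinct primes, then P_{S(p,q)}(x) = Φ_{pq}(x), i.e. the semigroup polynomial of the numerical semigroup generated by p and q equals the pq-th cyclotomic polynomial. -/
open Polynomial

lemma sg_aux1 (p q : ℕ) (hq : q.Prime) (hp : p.Prime) (hne : p ≠ q) :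
    hilbertSeries {n | ∃ x y : ℕ, n = x * p + y * q} * (1 - PowerSeries.X ^ q) =
      ∑ x ∈ Finset.range q, (PowerSeries.X ^ p) ^ x := by
  classical
  ext n
  rw [mul_sub, mul_one, map_sub, PowerSeries.coeff_mul_X_pow', map_sum]
  simp only [hilbertSeries, PowerSeries.coeff_mk, ← pow_mul, PowerSeries.coeff_X_pow,
    Set.indicator_apply, Set.mem_setOf_eq]
  have hR : (∑ x ∈ Finset.range q, if n = p * x then (1 : ℤ) else 0) =
      if ∃ x < q, n = p * x then 1 else 0 := by
    split_ifs with h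
    · obtain ⟨x, hx, rfl⟩ := h
      rw [Finset.sum_eq_single x]
      · simp
      · intro b _ hb
        rw [if_neg]
        intro h
        exact hb (Nat.eq_of_mul_eq_mul_left hp.pos h).symm
      · intro h
        exact absurd (Finset.mem_range.2 hx) h
    · apply Finset.sum_eq_zero
      intro x hx
      rw [if_neg]
      intro h'
      exact h ⟨x, Finset.mem_range.1 hx, h'⟩
  rw [hR]
  have h1 : (q ≤ n ∧ ∃ x y : ℕ, n - q = x * p + y * q) → ∃ x y : ℕ, n = x * p + y * q := by
    rintro ⟨h, x, y, e⟩
    exact ⟨x, y + 1, by rw [add_mul]; omega⟩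
  have h2 : (∃ x < q, n = p * x) → ∃ x y : ℕ, n = x * p + y * q := by
    rintro ⟨x, _, e⟩
    exact ⟨x, 0, by rw [e]; ring⟩
  have h3 : (∃ x < q, n = p * x) → ¬ (q ≤ n ∧ ∃ x y : ℕ, n - q = x * p + y * q) := by
    rintro ⟨x, hx, e⟩ ⟨hle, a, b, h⟩
    have e2 : p * x = a * p + (b + 1) * q := by rw [add_mul]; omega
    have hax : a < x := by
      have := hq.pos
      have := hp.pos
      by_contra hc
      push Not at hc
      have := Nat.mul_le_mul_left p hc
      have : 0 < (b + 1) * q := by positivity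
      linarith [mul_comm a p]
    obtain ⟨d, rfl⟩ := Nat.exists_eq_add_of_lt hax
    have hd : q ∣ p * (d + 1) := ⟨b + 1, by linarith⟩
    have hd2 := ((Nat.coprime_primes hq hp).2 hne.symm).dvd_of_dvd_mul_left hd
    have := Nat.le_of_dvd (by omega) hd2
    omega
  have h4 : (∃ x y : ℕ, n = x * p + y * q) → (∃ x < q, n = p * x) ∨
      (q ≤ n ∧ ∃ x y : ℕ, n - q = x * p + y * q) := by
    rintro ⟨x, y, e⟩
    rcases y with _ | y
    · by_cases hx : x < q
      · exact Or.inl ⟨x, hx, by rw [e]; ring⟩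
      · right
        obtain ⟨d, rfl⟩ := Nat.exists_eq_add_of_le (not_lt.1 hx)
        obtain ⟨r, hr⟩ : ∃ r, p = r + 1 := ⟨p - 1, by have := hp.pos; omega⟩
        have e2 : n = d * p + r * q + q := by rw [e, hr]; ring
        exact ⟨by omega, d, r, by omega⟩
    · right
      rw [add_mul] at e
      exact ⟨by omega, x, y, by omega⟩
  rw [← ite_and]
  by_cases hA : ∃ x < q, n = p * x
  · rw [if_pos (h2 hA), if_neg (h3 hA), if_pos hA]; rfl
  · by_cases hB : (q ≤ n ∧ ∃ x y : ℕ, n - q = x * p + y * q)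
    · rw [if_pos (h1 hB), if_pos hB, if_neg hA]; rfl
    · rw [if_neg (fun h => (h4 h).elim hA hB), if_neg hB, if_neg hA]; rfl

lemma sg_aux2 (p q : ℕ) (hp : p.Prime) (hq : q.Prime) (hne : p ≠ q) :
    cyclotomic (p * q) ℤ * ((X ^ p - 1) * (X ^ q - 1)) = (X ^ (p * q) - 1) * (X - 1) := by
  have := Fact.mk hp
  have h1 := cyclotomic_expand_eq_cyclotomic_mul (n := p) hq
    (fun h => hne ((Nat.prime_dvd_prime_iff_eq hq hp).1 h).symm) ℤ
  have h2 := cyclotomic_prime_mul_X_sub_one ℤ p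
  have h3 := congrArg (expand ℤ q) h2
  simp only [map_mul, map_sub, map_one, map_pow, expand_X, ← pow_mul] at h3
  rw [mul_comm p q, ← h3, ← h2, h1, mul_comm p q]
  ring

/-- For distinct primes `p` and `q`, the semigroup polynomial
`P_{S(p,q)}(x) = (1-x) ∑_{s ∈ S(p,q)} x^s` equals the `pq`-th cyclotomic polynomial. -/
theorem semigroup_polynomial_eq_cyclotomic (p q : ℕ) (hp : p.Prime) (hq : q.Prime)
    (hne : p ≠ q) :
    ((Polynomial.cyclotomic (p * q) ℤ : Polynomial ℤ) : PowerSeries ℤ) =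
      (1 - PowerSeries.X) * hilbertSeries {n | ∃ x y : ℕ, n = x * p + y * q} := by
  have h1 := sg_aux1 p q hq hp hne
  have h2 := congrArg (fun f : ℤ[X] => (f : PowerSeries ℤ)) (sg_aux2 p q hp hq hne)
  simp only [Polynomial.coe_mul, Polynomial.coe_sub, Polynomial.coe_pow, Polynomial.coe_X,
    Polynomial.coe_one] at h2
  have h3 := geom_sum_mul (PowerSeries.X ^ p : PowerSeries ℤ) q
  rw [← h1, ← pow_mul] at h3
  have hn : ∀ r : ℕ, r.Prime → (PowerSeries.X ^ r - 1 : PowerSeries ℤ) ≠ 0 := by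
    intro r hr h
    have := congrArg (PowerSeries.coeff 0) h
    simp [PowerSeries.coeff_X_pow, hr.ne_zero] at this
  apply mul_right_cancel₀ (mul_ne_zero (hn p hp) (hn q hq))
  rw [h2, ← h3]
  ring
end

section
/- If p and q are primes with 2 < p < q, then the maximum gap of the binary cyclotomic polynomial Φ_{pq} satisfies g(Φ_{pq}) = p − 1. -/
open Polynomial

/-- The maximum gap `g(f)` of a polynomial `f = c₁x^{e₁} + ⋯ + c_s x^{e_s}` (all `cᵢ ≠ 0`,
`e₁ < ⋯ < e_s`) is `max_{1 ≤ i < s} (e_{i+1} - e_i)`, and `0` if `s ≤ 1`. It is computed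
here as the supremum of `e' - e` over pairs `e < e'` of consecutive exponents of `f`. -/
def maxGap (f : Polynomial ℤ) : ℕ :=
  (f.support ×ˢ f.support).sup fun e =>
    if e.1 < e.2 ∧ ∀ c ∈ f.support, c ≤ e.1 ∨ e.2 ≤ c then e.2 - e.1 else 0

/-- Membership in the numerical semigroup generated by `p` and `q`. -/
def InSg (p q n : ℕ) : Prop := ∃ a b : ℕ, n = a * p + b * q

open Classical in
/-- indicator series of the semigroup -/
noncomputable def sgSeries (p q : ℕ) : PowerSeries ℤ :=
  PowerSeries.mk fun n => if InSg p q n then 1 else 0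

theorem inSg_add {p q n : ℕ} (h : InSg p q n) : InSg p q (n + p) := by
  obtain ⟨a, b, rfl⟩ := h
  exact ⟨a + 1, b, by ring⟩

theorem apery (p q n : ℕ) (hp : p.Prime) (hq : q.Prime) (hpq : p < q) :
    (InSg p q n ∧ ¬ (p ≤ n ∧ InSg p q (n - p))) ↔ ∃ j < p, n = q * j := by
  constructor
  · rintro ⟨⟨a, b, h⟩, hn⟩
    have ha : a = 0 := by
      by_contra ha
      obtain ⟨a, rfl⟩ := Nat.exists_eq_succ_of_ne_zero ha
      have h' : n = (a * p + b * q) + p := by rw [h, Nat.succ_eq_add_one]; ring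
      exact hn ⟨by omega, a, b, by omega⟩
    subst ha
    refine ⟨b, ?_, by rw [h]; ring⟩
    by_contra hb
    obtain ⟨b, rfl⟩ := Nat.exists_eq_add_of_le (not_lt.mp hb)
    obtain ⟨c, rfl⟩ := Nat.exists_eq_add_of_lt hpq
    have h' : n = ((p + c) * p + b * (p + c + 1)) + p := by rw [h]; ring
    exact hn ⟨by omega, p + c, b, by omega⟩
  · rintro ⟨j, hj, rfl⟩
    refine ⟨⟨0, j, by ring⟩, ?_⟩
    rintro ⟨hle, a, b, h⟩
    have h1 : q * j = (a + 1) * p + b * q := by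
      have : (a + 1) * p = a * p + p := by ring
      omega
    have hbj : b < j := by
      have := hp.pos
      by_contra hb
      have : q * j ≤ b * q := by rw [mul_comm]; exact Nat.mul_le_mul_right _ (not_lt.mp hb)
      have : 0 < (a + 1) * p := by positivity
      omega
    obtain ⟨c, rfl⟩ := Nat.exists_eq_add_of_lt hbj
    have h2 : q * (c + 1) = (a + 1) * p := by nlinarith
    have hd : p ∣ q * (c + 1) := ⟨a + 1, by rw [h2]; ring⟩
    have hc : Nat.Coprime p q := (Nat.coprime_primes hp hq).2 hpq.ne
    have := Nat.le_of_dvd (by omega) (hc.dvd_of_dvd_mul_left hd)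
    omega

theorem sg_mul (p q : ℕ) (hp : p.Prime) (hq : q.Prime) (hpq : p < q) :
    sgSeries p q * (1 - PowerSeries.X ^ p)
      = ((∑ j ∈ Finset.range p, (X : ℤ[X]) ^ (q * j) : ℤ[X]) : PowerSeries ℤ) := by
  classical
  ext n
  rw [mul_sub, mul_one, map_sub, PowerSeries.coeff_mul_X_pow', Polynomial.coeff_coe,
    Polynomial.finsetSum_coeff]
  simp only [sgSeries, PowerSeries.coeff_mk, coeff_X_pow]
  have h := apery p q n hp hq hpq
  have hR : (∑ j ∈ Finset.range p, if n = q * j then (1 : ℤ) else 0)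
      = if ∃ j < p, n = q * j then 1 else 0 := by
    split_ifs with hj
    · obtain ⟨j, hj, rfl⟩ := hj
      rw [Finset.sum_eq_single j]
      · simp
      · intro b _ hb
        rw [if_neg]
        intro h
        exact hb (Nat.eq_of_mul_eq_mul_left hq.pos h).symm
      · intro h
        simp at h; omega
    · apply Finset.sum_eq_zero
      intro j hj'
      rw [if_neg]
      intro h
      exact hj ⟨j, Finset.mem_range.1 hj', h⟩
  rw [hR]
  have h3 : p ≤ n ∧ InSg p q (n - p) → InSg p q n := by
    rintro ⟨h1, h2⟩
    have := inSg_add h2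
    rwa [Nat.sub_add_cancel h1] at this
  simp only [← h]
  by_cases h1 : InSg p q n <;> by_cases h2 : p ≤ n <;> by_cases h4 : InSg p q (n - p) <;>
    simp_all

theorem cyc_eq (p q : ℕ) (hp : p.Prime) (hq : q.Prime) (hpq : p < q) :
    ((cyclotomic (p * q) ℤ : ℤ[X]) : PowerSeries ℤ) = sgSeries p q * (1 - PowerSeries.X) := by
  have hnd : ¬ q ∣ p := fun h => by
    have := Nat.le_of_dvd hp.pos h
    omega
  have h1 := cyclotomic_expand_eq_cyclotomic_mul hq hnd ℤ
  have := Fact.mk hp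
  rw [cyclotomic_prime, map_sum] at h1
  simp only [map_pow, expand_X, ← pow_mul] at h1
  have h2 : (cyclotomic (p * q) ℤ) * (1 - X ^ p)
      = (∑ j ∈ Finset.range p, (X : ℤ[X]) ^ (q * j)) * (1 - X) := by
    rw [h1, mul_assoc, geom_sum_mul_neg]
  have h3 := congrArg (fun f : ℤ[X] => (f : PowerSeries ℤ)) h2
  simp only [Polynomial.coe_mul, Polynomial.coe_sub, Polynomial.coe_one, Polynomial.coe_pow,
    Polynomial.coe_X] at h3
  rw [← sg_mul p q hp hq hpq] at h3
  have hne : (1 - PowerSeries.X ^ p : PowerSeries ℤ) ≠ 0 := by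
    intro h
    have := congrArg (PowerSeries.coeff 0) h
    simp [hp.ne_zero] at this
  apply mul_right_cancel₀ hne
  rw [h3]; ring

theorem mem_supp (p q : ℕ) (hp : p.Prime) (hq : q.Prime) (hpq : p < q) (n : ℕ) :
    n + 1 ∈ (cyclotomic (p * q) ℤ).support ↔ ¬ (InSg p q (n + 1) ↔ InSg p q n) := by
  classical
  rw [Polynomial.mem_support_iff, ← Polynomial.coeff_coe, cyc_eq p q hp hq hpq, mul_sub, mul_one,
    map_sub, PowerSeries.coeff_succ_mul_X]
  simp only [sgSeries, PowerSeries.coeff_mk]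
  by_cases h1 : InSg p q n <;> by_cases h2 : InSg p q (n + 1) <;> simp [h1, h2]

theorem not_inSg {p q n : ℕ} (hpq : p < q) (h0 : 0 < n) (hn : n < p) : ¬ InSg p q n := by
  rintro ⟨a, b, h⟩
  rcases Nat.eq_zero_or_pos a with rfl | ha
  · rcases Nat.eq_zero_or_pos b with rfl | hb
    · omega
    · have := Nat.le_mul_of_pos_left q hb
      omega
  · have := Nat.le_mul_of_pos_left p ha
    omega

theorem const_run (p q : ℕ) (hp : p.Prime) (hq : q.Prime) (hpq : p < q) (e e' : ℕ)
    (h : ∀ c ∈ (cyclotomic (p * q) ℤ).support, c ≤ e ∨ e' ≤ c) (k : ℕ) (hk : e + k < e') :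
    InSg p q (e + k) ↔ InSg p q e := by
  induction k with
  | zero => rfl
  | succ k ih =>
    rw [← ih (by omega)]
    by_contra hc
    have := h _ ((mem_supp p q hp hq hpq (e + k)).2 hc)
    omega

/-- Hong, Lee, Lee and Park: for primes `2 < p < q`, the maximum gap of the binary
cyclotomic polynomial `Φ_{pq}` equals `p - 1`. -/
theorem maxGap_cyclotomic (p q : ℕ) (hp : p.Prime) (hq : q.Prime) (h2p : 2 < p)
    (hpq : p < q) :
    maxGap (Polynomial.cyclotomic (p * q) ℤ) = p - 1 := by
  have h0 : InSg p q 0 := ⟨0, 0, by ring⟩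
  have hpS : InSg p q p := ⟨1, 0, by ring⟩
  unfold maxGap
  apply le_antisymm
  · apply Finset.sup_le
    rintro ⟨e, e'⟩ he
    obtain ⟨-, he'⟩ := Finset.mem_product.1 he
    simp only at he' ⊢
    split_ifs with h
    · obtain ⟨hlt, hc⟩ := h
      by_contra hgap
      have hrun := const_run p q hp hq hpq e e' hc
      obtain ⟨m, rfl⟩ : ∃ m, e' = m + 1 := ⟨e' - 1, by omega⟩
      have hch := (mem_supp p q hp hq hpq m).1 he'
      have hm : InSg p q m ↔ InSg p q e := by
        have := hrun (m - e) (by omega)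
        rwa [show e + (m - e) = m by omega] at this
      by_cases hS : InSg p q e
      · have h1 := (hrun (m + 1 - p - e) (by omega)).2 hS
        have h2 := inSg_add h1
        rw [show e + (m + 1 - p - e) + p = m + 1 by omega] at h2
        tauto
      · -- a multiple of p in the run
        have hr := Nat.mod_lt (e + p - 1) hp.pos
        have hdiv := Nat.div_add_mod (e + p - 1) p
        have h1 := (hrun (p * ((e + p - 1) / p) - e) (by omega)).not.2 hS
        apply h1
        refine ⟨(e + p - 1) / p, 0, ?_⟩
        rw [mul_comm _ p]
        omega
    · omega
  · have h1 : 1 ∈ (cyclotomic (p * q) ℤ).support := by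
      rw [show 1 = 0 + 1 from rfl, mem_supp p q hp hq hpq]
      have := not_inSg (n := 0 + 1) hpq (by omega) (by omega)
      tauto
    have h2 : p ∈ (cyclotomic (p * q) ℤ).support := by
      obtain ⟨m, rfl⟩ : ∃ m, p = m + 1 := ⟨p - 1, by omega⟩
      rw [mem_supp (m + 1) q hp hq hpq]
      have := not_inSg (n := m) hpq (by omega) (by omega)
      tauto
    have hle := Finset.le_sup (f := fun e : ℕ × ℕ =>
      if e.1 < e.2 ∧ ∀ c ∈ (cyclotomic (p * q) ℤ).support, c ≤ e.1 ∨ e.2 ≤ c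
        then e.2 - e.1 else 0) (Finset.mem_product.2 ⟨h1, h2⟩ : ((1, p) : ℕ × ℕ) ∈ _)
    refine le_trans (le_of_eq ?_) hle
    simp only
    rw [if_pos]
    refine ⟨by omega, fun c hc => ?_⟩
    by_contra hcon
    obtain ⟨m, rfl⟩ : ∃ m, c = m + 1 := ⟨c - 1, by omega⟩
    have h3 := (mem_supp p q hp hq hpq m).1 hc
    have h4 := not_inSg (n := m) hpq (by omega) (by omega)
    have h5 := not_inSg (n := m + 1) hpq (by omega) (by omega)
    tauto
end

section
/- Let p, q > 1 be coprime integers and let ρ, σ be the unique nonnegative integers with 1 + pq = ρp + σq. Let 0 ≤ m < pq, let 0 ≤ α ≤ q−1 be the unique integer with αp ≡ m (mod q), and let 0 ≤ β ≤ p−1 be the unique integer with βq ≡ m (mod p). Then either m = αp + βq or m = αp + βq − pq, and the coefficient a_{p,q}(m) of x^m in Q_{p,q}(x) equals 1 if m = αp + βq with 0 ≤ α ≤ ρ−1 and 0 ≤ β ≤ σ−1; it equals −1 if m = αp + βq − pq with ρ ≤ α ≤ q−1 and σ ≤ β ≤ p−1; and it equals 0 otherwise. -/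
open Polynomial

lemma aux_uniq (p q : ℕ) (hpq : Nat.Coprime p q) (m α β n i j : ℕ)
    (hα : α < q) (hαp : α * p ≡ m [MOD q]) (hβ : β < p) (hβq : β * q ≡ m [MOD p])
    (hn1 : n ≡ m [MOD q]) (hn2 : n ≡ m [MOD p]) (hi : i < q) (hj : j < p)
    (h : i * p + j * q = n) : i = α ∧ j = β := by
  subst h
  constructor
  · have h1 : i * p ≡ α * p [MOD q] := by
      refine Nat.ModEq.trans ?_ (hn1.trans hαp.symm)
      simp [Nat.ModEq]
    exact (Nat.ModEq.cancel_right_of_coprime hpq.symm h1).eq_of_lt_of_lt hi hα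
  · have h1 : j * q ≡ β * q [MOD p] := by
      refine Nat.ModEq.trans ?_ (hn2.trans hβq.symm)
      simp [Nat.ModEq]
    exact (Nat.ModEq.cancel_right_of_coprime hpq h1).eq_of_lt_of_lt hj hβ

lemma aux_coeff (p q : ℕ) (hpq : Nat.Coprime p q) (m α β n : ℕ)
    (hα : α < q) (hαp : α * p ≡ m [MOD q]) (hβ : β < p) (hβq : β * q ≡ m [MOD p])
    (hn1 : n ≡ m [MOD q]) (hn2 : n ≡ m [MOD p]) (S T : Finset ℕ)
    (hS : ∀ i ∈ S, i < q) (hT : ∀ j ∈ T, j < p) :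
    ((∑ i ∈ S, (X : ℤ[X]) ^ (i * p)) * (∑ j ∈ T, (X : ℤ[X]) ^ (j * q))).coeff n =
      if n = α * p + β * q ∧ α ∈ S ∧ β ∈ T then 1 else 0 := by
  have key : ∀ i ∈ S, ∀ j ∈ T, i * p + j * q = n → i = α ∧ j = β := fun i hi j hj h =>
    aux_uniq p q hpq m α β n i j hα hαp hβ hβq hn1 hn2 (hS i hi) (hT j hj) h
  rw [Finset.sum_mul_sum]
  simp only [finsetSum_coeff, ← pow_add, coeff_X_pow]
  rw [← Finset.sum_product']
  split_ifs with h
  · obtain ⟨h1, h2, h3⟩ := h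
    rw [Finset.sum_eq_single (α, β)]
    · simp [h1]
    · rintro ⟨i, j⟩ hij hne
      rw [Finset.mem_product] at hij
      rw [if_neg]
      intro h
      obtain ⟨rfl, rfl⟩ := key i hij.1 j hij.2 h.symm
      exact hne rfl
    · intro h
      exact absurd (Finset.mem_product.2 ⟨h2, h3⟩) h
  · apply Finset.sum_eq_zero
    rintro ⟨i, j⟩ hij
    rw [Finset.mem_product] at hij
    rw [if_neg]
    intro h'
    obtain ⟨rfl, rfl⟩ := key i hij.1 j hij.2 h'.symm
    exact h ⟨h', hij.1, hij.2⟩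

lemma aux_Ico (a b p : ℕ) (h : a ≤ b) :
    (∑ i ∈ Finset.Ico a b, (X : ℤ[X]) ^ (i * p)) * (X ^ p - 1) = X ^ (b * p) - X ^ (a * p) := by
  have := geom_sum_Ico_mul ((X : ℤ[X]) ^ p) h
  simpa only [← pow_mul, mul_comm p] using this


open Polynomial

/-- Coefficient description of the binary inclusion–exclusion polynomial
`Q_{p,q}(x) = (x^{pq}-1)(x-1)/((x^p-1)(x^q-1))` for coprime `p, q > 1` (Lam–Leung/Lenstra).
Here `ρ, σ` are the nonnegative integers with `1 + pq = ρp + σq`, and for `0 ≤ m < pq`,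
`α < q` and `β < p` are the unique integers with `αp ≡ m (mod q)` and `βq ≡ m (mod p)`. -/
theorem coeff_binary_inclusion_exclusion (p q : ℕ) (hp : 1 < p) (hq : 1 < q)
    (hpq : Nat.Coprime p q) (ρ σ : ℕ) (hρσ : 1 + p * q = ρ * p + σ * q)
    (m α β : ℕ) (hm : m < p * q)
    (hα : α ≤ q - 1) (hαp : α * p ≡ m [MOD q])
    (hβ : β ≤ p - 1) (hβq : β * q ≡ m [MOD p])
    (Q : Polynomial ℤ)
    (hQ : Q * ((Polynomial.X ^ p - 1) * (Polynomial.X ^ q - 1)) =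
      (Polynomial.X ^ (p * q) - 1) * (Polynomial.X - 1)) :
    ((m : ℤ) = α * p + β * q ∨ (m : ℤ) = α * p + β * q - p * q) ∧
    Q.coeff m =
      if (m : ℤ) = α * p + β * q ∧ α < ρ ∧ β < σ then 1
      else if (m : ℤ) = α * p + β * q - p * q ∧ ρ ≤ α ∧ σ ≤ β then -1
      else 0 := by
  have hα' : α < q := by omega
  have hβ' : β < p := by omega
  have hσ0 : 0 < σ := by
    rcases Nat.eq_zero_or_pos σ with h | h
    · subst h
      have : p ∣ 1 := (Nat.dvd_add_left (Dvd.intro q rfl)).1 (hρσ ▸ ⟨ρ, by ring⟩)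
      have := Nat.le_of_dvd one_pos this
      omega
    · exact h
  have hρ0 : 0 < ρ := by
    rcases Nat.eq_zero_or_pos ρ with h | h
    · subst h
      have : q ∣ 1 := (Nat.dvd_add_left (Dvd.intro_left p rfl)).1 (hρσ ▸ ⟨σ, by ring⟩)
      have := Nat.le_of_dvd one_pos this
      omega
    · exact h
  have hρq : ρ ≤ q := by
    by_contra h
    push Not at h
    nlinarith
  have hσp : σ ≤ p := by
    by_contra h
    push Not at h
    nlinarith
  have hmod : α * p + β * q ≡ m [MOD p * q] := by
    rw [← Nat.modEq_and_modEq_iff_modEq_mul hpq]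
    constructor
    · refine Nat.ModEq.trans ?_ hβq
      simp [Nat.ModEq]
    · refine Nat.ModEq.trans ?_ hαp
      simp [Nat.ModEq]
  have hdich : α * p + β * q = m ∨ α * p + β * q = m + p * q := by
    have h1 : α * p + β * q < 2 * (p * q) := by nlinarith
    rw [Nat.ModEq, Nat.mod_eq_of_lt hm] at hmod
    have h2 := Nat.div_add_mod (α * p + β * q) (p * q)
    rw [hmod] at h2
    have h3 : (α * p + β * q) / (p * q) < 2 := Nat.div_lt_of_lt_mul (by linarith)
    interval_cases (α * p + β * q) / (p * q)
    · left; omega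
    · right; omega
  have hpos : 0 < p * q := by positivity
  have hXp : (X ^ p - 1 : ℤ[X]) ≠ 0 := X_pow_sub_C_ne_zero (by omega) 1
  have hXq : (X ^ q - 1 : ℤ[X]) ≠ 0 := X_pow_sub_C_ne_zero (by omega) 1
  have hid : Q * X ^ (p * q) =
      ((∑ i ∈ Finset.Ico 0 ρ, (X : ℤ[X]) ^ (i * p)) * (∑ j ∈ Finset.Ico 0 σ, (X : ℤ[X]) ^ (j * q)))
        * X ^ (p * q) -
      (∑ i ∈ Finset.Ico ρ q, (X : ℤ[X]) ^ (i * p)) * (∑ j ∈ Finset.Ico σ p, (X : ℤ[X]) ^ (j * q)) := by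
    apply mul_right_cancel₀ (mul_ne_zero hXp hXq)
    have e1 := aux_Ico 0 ρ p (Nat.zero_le _)
    have e2 := aux_Ico 0 σ q (Nat.zero_le _)
    have e3 := aux_Ico ρ q p hρq
    have e4 := aux_Ico σ p q hσp
    have e5 : (X : ℤ[X]) ^ (ρ * p) * X ^ (σ * q) = X * X ^ (p * q) := by
      rw [← pow_add, ← hρσ, pow_add, pow_one]
    rw [mul_comm q p] at e3
    simp only [zero_mul, pow_zero] at e1 e2
    generalize (∑ i ∈ Finset.Ico 0 ρ, (X : ℤ[X]) ^ (i * p)) = A at *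
    generalize (∑ i ∈ Finset.Ico 0 σ, (X : ℤ[X]) ^ (i * q)) = B at *
    generalize (∑ i ∈ Finset.Ico ρ q, (X : ℤ[X]) ^ (i * p)) = C at *
    generalize (∑ i ∈ Finset.Ico σ p, (X : ℤ[X]) ^ (i * q)) = D at *
    calc _ = (Q * ((X ^ p - 1) * (X ^ q - 1))) * X ^ (p * q) := by ring
      _ = (X ^ (p * q) - 1) * (X - 1) * X ^ (p * q) := by rw [hQ]
      _ = (X ^ (ρ * p) - 1) * (X ^ (σ * q) - 1) * X ^ (p * q)
          - (X ^ (p * q) - X ^ (ρ * p)) * (X ^ (p * q) - X ^ (σ * q)) := by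
        linear_combination (1 - X ^ (p * q)) * e5
      _ = (A * (X ^ p - 1)) * (B * (X ^ q - 1)) * X ^ (p * q)
          - (C * (X ^ p - 1)) * (D * (X ^ q - 1)) := by rw [e1, e2, e3, e4]
      _ = _ := by ring
  have hc := congrArg (fun P : ℤ[X] => P.coeff (m + p * q)) hid
  simp only [coeff_sub, coeff_mul_X_pow] at hc
  rw [aux_coeff p q hpq m α β m hα' hαp hβ' hβq rfl rfl _ _
      (fun i hi => by rw [Finset.mem_Ico] at hi; omega)
      (fun i hi => by rw [Finset.mem_Ico] at hi; omega),
    aux_coeff p q hpq m α β (m + p * q) hα' hαp hβ' hβq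
      (by simp [Nat.ModEq]) (by simp [Nat.ModEq]) _ _
      (fun i hi => by rw [Finset.mem_Ico] at hi; omega)
      (fun i hi => by rw [Finset.mem_Ico] at hi; omega)] at hc
  simp only [Finset.mem_Ico] at hc
  have c1 : ((m : ℤ) = α * p + β * q) ↔ m = α * p + β * q := by norm_cast
  have c2 : ((m : ℤ) = α * p + β * q - p * q) ↔ m + p * q = α * p + β * q := by
    rw [eq_sub_iff_add_eq]; norm_cast
  simp only [c1, c2, hc]
  refine ⟨by omega, ?_⟩
  generalize α * p + β * q = s at *
  generalize p * q = t at *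
  split_ifs <;> first | rfl | omega
end

section
/- Let p, q > 1 be coprime integers and let ρ, σ be the unique nonnegative integers with 1 + pq = ρp + σq. Then the number of positive coefficients of Q_{p,q}(x) equals ρσ, the number of negative coefficients equals ρσ − 1, and the number of nonzero coefficients equals 2ρσ − 1. -/
open Polynomial

lemma bie_inj (p q : ℕ) (hpq : Nat.Coprime p q) (a b c d : ℕ) (ha : a < q) (hc : c < q)
    (h : a * p + b * q ≡ c * p + d * q [MOD q]) : a = c := by
  have h2 : a * p ≡ c * p [MOD q] := by
    simpa [Nat.ModEq] using h
  have h3 : a ≡ c [MOD q] := Nat.ModEq.cancel_right_of_coprime (by simpa using hpq.symm) h2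
  exact Nat.ModEq.eq_of_lt_of_lt h3 ha hc

lemma bie_geom (p q m n : ℕ) :
    (∑ x ∈ Finset.range m ×ˢ Finset.range n, (X : ℤ[X]) ^ (x.1 * p + x.2 * q)) *
      ((X ^ p - 1) * (X ^ q - 1)) = (X ^ (m * p) - 1) * (X ^ (n * q) - 1) := by
  have e : (∑ x ∈ Finset.range m ×ˢ Finset.range n, (X : ℤ[X]) ^ (x.1 * p + x.2 * q)) =
      (∑ i ∈ Finset.range m, (X ^ p) ^ i) * (∑ i ∈ Finset.range n, (X ^ q) ^ i) := by
    rw [Finset.sum_mul_sum, Finset.sum_product]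
    refine Finset.sum_congr rfl fun i _ => Finset.sum_congr rfl fun j _ => ?_
    rw [pow_add, mul_comm i, mul_comm j, pow_mul, pow_mul]
  rw [e, mul_comm m, mul_comm n, pow_mul, pow_mul, ← geom_sum_mul (X ^ p : ℤ[X]),
    ← geom_sum_mul (X ^ q : ℤ[X])]
  ring

/-- Carlitz: for coprime `p, q > 1`, with `ρ, σ` the nonnegative integers satisfying
`1 + pq = ρp + σq`, the binary inclusion–exclusion polynomial
`Q_{p,q}(x) = (x^{pq}-1)(x-1)/((x^p-1)(x^q-1))` has exactly `ρσ` positive coefficients,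
`ρσ - 1` negative coefficients, and `2ρσ - 1` nonzero coefficients. -/
theorem coefficient_counts_binary_inclusion_exclusion (p q : ℕ) (hp : 1 < p) (hq : 1 < q)
    (hpq : Nat.Coprime p q) (ρ σ : ℕ) (hρσ : 1 + p * q = ρ * p + σ * q)
    (Q : Polynomial ℤ)
    (hQ : Q * ((Polynomial.X ^ p - 1) * (Polynomial.X ^ q - 1)) =
      (Polynomial.X ^ (p * q) - 1) * (Polynomial.X - 1)) :
    (Q.support.filter fun k => 0 < Q.coeff k).card = ρ * σ ∧
    (Q.support.filter fun k => Q.coeff k < 0).card = ρ * σ - 1 ∧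
    Q.support.card = 2 * ρ * σ - 1 := by
  have hρ0 : 0 < ρ := by
    rcases Nat.eq_zero_or_pos ρ with h | h
    · subst h
      have : q ∣ 1 := (Nat.dvd_add_left (Dvd.intro_left p rfl)).1 ⟨σ, by rw [hρσ]; ring⟩
      have := Nat.le_of_dvd one_pos this
      omega
    · exact h
  have hσ0 : 0 < σ := by
    rcases Nat.eq_zero_or_pos σ with h | h
    · subst h
      have : p ∣ 1 := (Nat.dvd_add_left (Dvd.intro q rfl)).1 ⟨ρ, by rw [hρσ]; ring⟩
      have := Nat.le_of_dvd one_pos this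
      omega
    · exact h
  have hρq : ρ < q := by
    by_contra! h
    nlinarith [Nat.mul_le_mul_right p h, Nat.mul_le_mul_right q hσ0]
  have hσp : σ < p := by
    by_contra! h
    nlinarith [Nat.mul_le_mul_right q h, Nat.mul_le_mul_right p hρ0]
  obtain ⟨m, hqd⟩ := Nat.exists_eq_add_of_lt hρq
  obtain ⟨n, hpd⟩ := Nat.exists_eq_add_of_lt hσp
  have e1 : 1 + (m + 1) * p = σ * q := by
    have : p * q = ρ * p + (m + 1) * p := by nth_rw 1 [hqd]; ring
    omega
  have e2 : 1 + (n + 1) * q = ρ * p := by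
    have : p * q = σ * q + (n + 1) * q := by nth_rw 1 [hpd]; ring
    omega
  have e3 : 1 + (m + 1) * p + (n + 1) * q = p * q := by omega
  have hcard : (m + 1) * (n + 1) = ρ * σ - 1 := by
    have : (m + 1) * (n + 1) + 1 = ρ * σ := by
      rw [hpd] at e1; rw [hqd] at e1; nlinarith
    omega
  have hQ2 : Q = (∑ x ∈ Finset.range ρ ×ˢ Finset.range σ, (X : ℤ[X]) ^ (x.1 * p + x.2 * q)) -
      X * ∑ x ∈ Finset.range (m+1) ×ˢ Finset.range (n+1), (X : ℤ[X]) ^ (x.1 * p + x.2 * q) := by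
    have hne : ((X : ℤ[X]) ^ p - 1) * (X ^ q - 1) ≠ 0 :=
      mul_ne_zero (X_pow_sub_C_ne_zero (by omega) 1) (X_pow_sub_C_ne_zero (by omega) 1)
    apply mul_right_cancel₀ hne
    have g1 := bie_geom p q ρ σ
    have g2 := bie_geom p q (m + 1) (n + 1)
    have f1 : (X : ℤ[X]) * X ^ ((m + 1) * p) = X ^ (σ * q) := by rw [← e1, pow_add, pow_one]
    have f2 : (X : ℤ[X]) * X ^ ((n + 1) * q) = X ^ (ρ * p) := by rw [← e2, pow_add, pow_one]
    have f3 : (X : ℤ[X]) * X ^ ((m + 1) * p) * X ^ ((n + 1) * q) = X ^ (p * q) := by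
      rw [← e3, pow_add, pow_add, pow_one]
    have f4 : (X : ℤ[X]) * X ^ (p * q) = X ^ (ρ * p) * X ^ (σ * q) := by
      rw [← pow_add, ← hρσ, pow_add, pow_one]
    linear_combination hQ - g1 + X * g2 + f4 + f3 - f1 - f2
  set S := (Finset.range ρ ×ˢ Finset.range σ).image (fun x => x.1 * p + x.2 * q) with hS
  set T := (Finset.range (m+1) ×ˢ Finset.range (n+1)).image (fun x => 1 + (x.1 * p + x.2 * q))
    with hT
  have key : ∀ a b c d : ℕ, a < q → c < q → a * p + b * q = c * p + d * q → a = c ∧ b = d := by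
    intro a b c d ha hc h
    have h1 : a = c := bie_inj p q hpq a b c d ha hc (by rw [h])
    subst h1
    exact ⟨rfl, Nat.eq_of_mul_eq_mul_right (by omega) (Nat.add_left_cancel h)⟩
  have injS : Set.InjOn (fun x : ℕ × ℕ => x.1 * p + x.2 * q)
      (Finset.range ρ ×ˢ Finset.range σ : Finset (ℕ × ℕ)) := by
    rintro ⟨a, b⟩ h1 ⟨c, d⟩ h2 h
    simp only [Finset.coe_product, Finset.coe_range, Set.mem_prod, Set.mem_Iio] at h1 h2 h
    obtain ⟨h3, h4⟩ := key a b c d (by omega) (by omega) h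
    rw [h3, h4]
  have injT : Set.InjOn (fun x : ℕ × ℕ => 1 + (x.1 * p + x.2 * q))
      (Finset.range (m+1) ×ˢ Finset.range (n+1) : Finset (ℕ × ℕ)) := by
    rintro ⟨a, b⟩ h1 ⟨c, d⟩ h2 h
    simp only [Finset.coe_product, Finset.coe_range, Set.mem_prod, Set.mem_Iio] at h1 h2 h
    obtain ⟨h3, h4⟩ := key a b c d (by omega) (by omega) (by omega)
    rw [h3, h4]
  have cS : S.card = ρ * σ := by
    rw [hS, Finset.card_image_of_injOn injS]; simp
  have cT : T.card = ρ * σ - 1 := by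
    rw [hT, Finset.card_image_of_injOn injT, ← hcard]; simp
  have disj : Disjoint S T := by
    rw [Finset.disjoint_left]
    intro k h1 h2
    simp only [hS, hT, Finset.mem_image, Finset.mem_product, Finset.mem_range, Prod.exists]
      at h1 h2
    obtain ⟨a, b, ⟨ha, hb⟩, rfl⟩ := h1
    obtain ⟨c, d, ⟨hc, hd⟩, h⟩ := h2
    have := key a (b + p) (ρ + c) (σ + d) (by omega) (by omega) (by nlinarith)
    omega
  have hQ3 : Q = ∑ k ∈ S, (X : ℤ[X]) ^ k - ∑ k ∈ T, (X : ℤ[X]) ^ k := by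
    rw [hQ2, hS, hT, Finset.sum_image injS, Finset.sum_image injT, Finset.mul_sum]
    simp only [pow_add, pow_one]
  have hc : ∀ k, Q.coeff k = (if k ∈ S then 1 else 0) - (if k ∈ T then 1 else 0) := by
    intro k
    rw [hQ3]
    simp [coeff_X_pow]
  have hd : ∀ k, k ∈ S → k ∉ T := fun k hk => Finset.disjoint_left.1 disj hk
  clear_value S T
  clear hQ3 hQ2 hQ key injS injT hcard e1 e2 e3 hqd hpd
  have g1 : (Q.support.filter fun k => 0 < Q.coeff k) = S := by
    ext k
    have := hd k
    simp only [Finset.mem_filter, mem_support_iff, hc]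
    by_cases h1 : k ∈ S <;> by_cases h2 : k ∈ T <;> simp [h1, h2] at this ⊢
  have g2 : (Q.support.filter fun k => Q.coeff k < 0) = T := by
    ext k
    have := hd k
    simp only [Finset.mem_filter, mem_support_iff, hc]
    by_cases h1 : k ∈ S <;> by_cases h2 : k ∈ T <;> simp [h1, h2] at this ⊢
  have g3 : Q.support = S ∪ T := by
    ext k
    have := hd k
    simp only [Finset.mem_union, mem_support_iff, hc]
    by_cases h1 : k ∈ S <;> by_cases h2 : k ∈ T <;> simp [h1, h2] at this ⊢
  refine ⟨by rw [g1, cS], by rw [g2, cT], ?_⟩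
  rw [g3, Finset.card_union_of_disjoint disj, cS, cT, mul_assoc]
  have := Nat.mul_pos hρ0 hσ0
  omega
end

section
/- Let S be a numerical semigroup with Frobenius number F(S). Then S is symmetric if and only if its semigroup polynomial P_S(x) is selfreciprocal, i.e. x^{F(S)+1}·P_S(1/x) = P_S(x). -/
open Polynomial

/-- A numerical semigroup `S` with Frobenius number `F` is symmetric
(`S ∪ (F - S) = ℤ`) if and only if its semigroup polynomial
`P_S(x) = (1-x) ∑_{s ∈ S} x^s`, a polynomial of degree `F + 1`, is selfreciprocal,
i.e. `x^{F+1} P_S(1/x) = P_S(x)`. -/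
theorem symmetric_iff_selfreciprocal (S : Set ℕ) (h0 : 0 ∈ S)
    (hadd : ∀ a ∈ S, ∀ b ∈ S, a + b ∈ S) (hfin : Sᶜ.Finite)
    (F : ℕ) (hF : F ∉ S) (hF' : ∀ n, F < n → n ∈ S)
    (P : Polynomial ℤ)
    (hP : (P : PowerSeries ℤ) = (1 - PowerSeries.X) * hilbertSeries S) :
    (∀ z : ℤ, (∃ s ∈ S, (s : ℤ) = z) ∨ (∃ s ∈ S, (F : ℤ) - s = z)) ↔
      Polynomial.reflect (F + 1) P = P := by
  classical
  obtain ⟨c, hc⟩ : ∃ c : ℕ → ℤ, c = fun n => Set.indicator S (fun _ => (1 : ℤ)) n := ⟨_, rfl⟩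
  have c1 : ∀ n, n ∈ S → c n = 1 := fun n h => by simp [hc, h]
  have c2 : ∀ n, n ∉ S → c n = 0 := fun n h => by simp [hc, h]
  have hH : hilbertSeries S = PowerSeries.mk c := by rw [hc]; rfl
  rw [hH] at hP
  have p0 : P.coeff 0 = 1 := by
    rw [← Polynomial.coeff_coe, hP, sub_mul, one_mul]
    simp [c1 0 h0]
  have p1 : ∀ n, P.coeff (n + 1) = c (n + 1) - c n := by
    intro n
    rw [← Polynomial.coeff_coe, hP, sub_mul, one_mul, map_sub, PowerSeries.coeff_succ_X_mul]
    simp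
  have key : (∀ z : ℤ, (∃ s ∈ S, (s : ℤ) = z) ∨ (∃ s ∈ S, (F : ℤ) - s = z)) ↔
      ∀ a b, a + b = F → c a + c b = 1 := by
    constructor
    · intro h a b hab
      have hn : ¬ (a ∈ S ∧ b ∈ S) := fun hh => hF (hab ▸ hadd a hh.1 b hh.2)
      have ho : a ∈ S ∨ b ∈ S := by
        rcases h a with ⟨s, hs, e⟩ | ⟨s, hs, e⟩
        · left
          have : s = a := by omega
          exact this ▸ hs
        · right
          have : s = b := by omega
          exact this ▸ hs
      rcases ho with ha | hb
      · rw [c1 a ha, c2 b (fun hb => hn ⟨ha, hb⟩)]; rfl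
      · rw [c1 b hb, c2 a (fun ha => hn ⟨ha, hb⟩)]; rfl
    · intro h z
      by_cases hz : z < 0
      · exact Or.inr ⟨(F - z).toNat, hF' _ (by omega), by omega⟩
      by_cases hz' : (F : ℤ) < z
      · exact Or.inl ⟨z.toNat, hF' _ (by omega), by omega⟩
      have := h z.toNat (F - z.toNat) (by omega)
      by_cases ha : z.toNat ∈ S
      · exact Or.inl ⟨_, ha, by omega⟩
      by_cases hb : F - z.toNat ∈ S
      · exact Or.inr ⟨_, hb, by omega⟩
      rw [c2 _ ha, c2 _ hb] at this
      omega
  have pF : P.coeff (F + 1) = 1 := by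
    rw [p1, c1 _ (hF' _ (Nat.lt_succ_self F)), c2 _ hF]; rfl
  rw [key]
  constructor
  · intro h
    ext n
    rw [Polynomial.coeff_reflect]
    by_cases hn : n ≤ F + 1
    · rw [Polynomial.revAt_le hn]
      rcases n with _ | k
      · rw [Nat.sub_zero, pF, p0]
      · by_cases hk : k = F
        · subst hk
          rw [Nat.sub_self, pF, p0]
        · obtain ⟨m, hm⟩ : ∃ m, F = k + 1 + m := ⟨F - (k + 1), by omega⟩
          have e : F + 1 - (k + 1) = m + 1 := by omega
          rw [e, p1, p1]
          have h1 := h k (m + 1) (by omega)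
          have h2 := h (k + 1) m (by omega)
          linarith
    · rw [Polynomial.revAt_eq_self_of_lt (by omega)]
  · intro h a
    induction a with
    | zero =>
      intro b hb
      have : b = F := by omega
      rw [this, c1 0 h0, c2 F hF]; rfl
    | succ k ih =>
      intro m hm
      have h1 := ih (m + 1) (by omega)
      have h2 := congrArg (fun Q => Polynomial.coeff Q (k + 1)) h
      simp only [Polynomial.coeff_reflect] at h2
      have e : F + 1 - (k + 1) = m + 1 := by omega
      rw [Polynomial.revAt_le (by omega), e, p1, p1] at h2
      linarith
end

section
/- Every numerical semigroup of embedding dimension 2 is symmetric; equivalently, for coprime integers p, q > 1 the numerical semigroup S(p,q) is symmetric. -/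
/-- Every numerical semigroup of embedding dimension 2 is symmetric: for coprime
`p, q > 1`, the numerical semigroup `S(p,q)` with Frobenius number `F` satisfies
`S(p,q) ∪ (F - S(p,q)) = ℤ`. -/
theorem two_generated_is_symmetric (p q : ℕ) (hp : 1 < p) (hq : 1 < q)
    (hpq : Nat.Coprime p q) (F : ℕ)
    (hF : F ∉ {n : ℕ | ∃ x y : ℕ, n = x * p + y * q})
    (hF' : ∀ n, F < n → n ∈ {n : ℕ | ∃ x y : ℕ, n = x * p + y * q}) :
    ∀ z : ℤ,
      (∃ s ∈ {n : ℕ | ∃ x y : ℕ, n = x * p + y * q}, (s : ℤ) = z) ∨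
      (∃ s ∈ {n : ℕ | ∃ x y : ℕ, n = x * p + y * q}, (F : ℤ) - s = z) := by
  have rep : ∀ z : ℤ, ∃ x y : ℤ, 0 ≤ x ∧ x < q ∧ z = x * p + y * q := by
    intro z
    have hb : (1 : ℤ) = p * Nat.gcdA p q + q * Nat.gcdB p q := by
      have h := Nat.gcd_eq_gcd_ab p q
      rw [hpq] at h
      simpa using h
    have hq0 : (0 : ℤ) < q := by omega
    refine ⟨(z * Nat.gcdA p q) % q, z * Nat.gcdB p q + p * ((z * Nat.gcdA p q) / q),
      Int.emod_nonneg _ hq0.ne', Int.emod_lt_of_pos _ hq0, ?_⟩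
    have h := Int.emod_add_mul_ediv (z * Nat.gcdA p q) q
    linear_combination z * hb - (p : ℤ) * h
  have key : (F : ℤ) = p * q - p - q := by
    apply le_antisymm
    · obtain ⟨x, y, hx0, hxq, h⟩ := rep F
      by_cases hy : 0 ≤ y
      · exfalso
        apply hF
        refine ⟨x.toNat, y.toNat, ?_⟩
        zify
        rw [Int.toNat_of_nonneg hx0, Int.toNat_of_nonneg hy]
        exact h
      · have h1 : (x + 1) * p ≤ q * (p : ℤ) :=
          mul_le_mul_of_nonneg_right (by omega) (by omega)
        have h2 : y * q ≤ (-1) * (q : ℤ) :=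
          mul_le_mul_of_nonneg_right (by omega) (by omega)
        linarith
    · by_contra hlt
      push Not at hlt
      obtain ⟨G, hG⟩ := Int.eq_ofNat_of_zero_le (a := p * q - p - q) (by omega)
      obtain ⟨x, y, hxy⟩ := hF' G (by omega)
      have e : (x + 1) * p + (y + 1) * q = p * q := by
        zify
        have : (G : ℤ) = x * p + y * q := by exact_mod_cast hxy
        linarith
      have d1 : q ∣ x + 1 := by
        apply hpq.symm.dvd_of_dvd_mul_right
        exact (Nat.dvd_add_left (Dvd.intro_left (y + 1) rfl)).1 (e ▸ Dvd.intro_left p rfl)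
      have l1 := Nat.mul_le_mul_right p (Nat.le_of_dvd (by omega) d1)
      have : 0 < (y + 1) * q := by positivity
      nlinarith
  intro z
  obtain ⟨x, y, hx0, hxq, h⟩ := rep z
  by_cases hy : 0 ≤ y
  · left
    refine ⟨x.toNat * p + y.toNat * q, ⟨_, _, rfl⟩, ?_⟩
    push_cast
    rw [Int.toNat_of_nonneg hx0, Int.toNat_of_nonneg hy, h]
  · right
    refine ⟨(q - 1 - x).toNat * p + (-1 - y).toNat * q, ⟨_, _, rfl⟩, ?_⟩
    push_cast
    rw [Int.toNat_of_nonneg (by omega), Int.toNat_of_nonneg (by omega), h, key]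
    ring
end

section
/- Let p, q > 1 be coprime integers. Then the genus of S(p,q) equals (p−1)(q−1)/2; that is, exactly (p−1)(q−1)/2 nonnegative integers are not representable as xp + yq with x, y nonnegative integers. -/
theorem aux_rep (p q : ℕ) (hq : 1 < q) (hpq : Nat.Coprime p q) (n : ℤ) :
    ∃ x y : ℤ, 0 ≤ x ∧ x < q ∧ n = x * p + y * q := by
  have hb : (1 : ℤ) = p * Nat.gcdA p q + q * Nat.gcdB p q := by
    rw [← Nat.gcd_eq_gcd_ab, hpq.gcd_eq_one]; rfl
  have hq0 : (0 : ℤ) < q := by omega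
  refine ⟨(n * Nat.gcdA p q) % q, n * Nat.gcdB p q + p * ((n * Nat.gcdA p q) / q),
    Int.emod_nonneg _ hq0.ne', Int.emod_lt_of_pos _ hq0, ?_⟩
  have h := Int.emod_add_mul_ediv (n * Nat.gcdA p q) q
  linear_combination n * hb - p * h

theorem aux_iff (p q : ℕ) (hpq : Nat.Coprime p q) (hq : 1 < q) (n : ℕ) (x y : ℤ)
    (h0 : 0 ≤ x) (h1 : x < q) (h : (n : ℤ) = x * p + y * q) :
    (∃ x y : ℕ, n = x * p + y * q) ↔ 0 ≤ y := by
  constructor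
  · rintro ⟨a, b, hab⟩
    by_contra hy
    push Not at hy
    have hab' : (n : ℤ) = a * p + b * q := by exact_mod_cast hab
    have e : (x - a) * p = (b - y) * q := by linear_combination hab' - h
    have hd : (q : ℤ) ∣ x - a := by
      have hc : IsCoprime (q : ℤ) (p : ℤ) := (Nat.isCoprime_iff_coprime.mpr hpq).symm
      exact hc.dvd_of_dvd_mul_right ⟨b - y, by rw [e]; ring⟩
    have hle : x - a ≤ 0 := by
      by_contra hcon
      have := Int.le_of_dvd (by omega) hd
      omega
    have h2 : (x - a) * p ≤ 0 := mul_nonpos_of_nonpos_of_nonneg hle (by omega)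
    have h3 : 0 < (b - y) * (q : ℤ) := mul_pos (by omega) (by omega)
    omega
  · intro hy
    lift x to ℕ using h0
    lift y to ℕ using hy
    exact ⟨x, y, by exact_mod_cast h⟩

/-- Sylvester: for coprime `p, q > 1`, the genus of `S(p,q)` equals `(p-1)(q-1)/2`;
that is, exactly `(p-1)(q-1)/2` nonnegative integers are not representable as
`xp + yq` with `x, y ≥ 0`. -/
theorem genus_two_generators (p q : ℕ) (hp : 1 < p) (hq : 1 < q)
    (hpq : Nat.Coprime p q) :
    Nat.card {n : ℕ | ¬∃ x y : ℕ, n = x * p + y * q} = (p - 1) * (q - 1) / 2 := by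
  classical
  set R : ℕ → Prop := fun n => ∃ x y : ℕ, n = x * p + y * q with hR
  obtain ⟨M, hM⟩ : ∃ M, M = (p - 1) * (q - 1) := ⟨_, rfl⟩
  have hMZ : (M : ℤ) = (p - 1) * (q - 1) := by
    rw [hM]; push_cast [Nat.cast_sub hp.le, Nat.cast_sub hq.le]; ring
  have big : ∀ n, M ≤ n → R n := by
    intro n hn
    obtain ⟨a, b, h⟩ := Nat.exists_add_mul_eq_of_gcd_dvd_of_mul_pred_le p q n
      (by rw [hpq.gcd_eq_one]; exact one_dvd _) (by simpa [hM] using hn)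
    exact ⟨a, b, h.symm⟩
  have sym : ∀ n, n < M → (R (M - 1 - n) ↔ ¬ R n) := by
    intro n hn
    obtain ⟨x, y, h0, h1, h⟩ := aux_rep p q hq hpq n
    have e : ((M - 1 - n : ℕ) : ℤ) = (q - 1 - x) * p + (-1 - y) * q := by
      have : ((M - 1 - n : ℕ) : ℤ) = M - 1 - n := by omega
      rw [this, hMZ, h]; ring
    have i1 := aux_iff p q hpq hq n x y h0 h1 h
    have i2 := aux_iff p q hpq hq (M - 1 - n) _ _ (by omega) (by omega) e
    simp only [hR]
    rw [i1, i2]; omega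
  have hset : {n : ℕ | ¬ R n} = ((Finset.range M).filter (fun n => ¬ R n) : Finset ℕ) := by
    ext n
    simp only [Set.mem_setOf_eq, Finset.coe_filter, Finset.mem_range]
    refine ⟨fun h => ⟨?_, h⟩, fun h => h.2⟩
    by_contra hc
    exact h (big n (by omega))
  have hcard : ((Finset.range M).filter (fun n => ¬ R n)).card
      = ((Finset.range M).filter R).card := by
    refine Finset.card_bij' (fun n _ => M - 1 - n) (fun n _ => M - 1 - n) ?_ ?_ ?_ ?_
    · intro n hn
      simp only [Finset.mem_filter, Finset.mem_range] at hn ⊢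
      exact ⟨by omega, (sym n hn.1).2 hn.2⟩
    · intro n hn
      simp only [Finset.mem_filter, Finset.mem_range] at hn ⊢
      exact ⟨by omega, fun h => (sym n hn.1).1 h hn.2⟩
    · intro n hn
      simp only [Finset.mem_filter, Finset.mem_range] at hn
      omega
    · intro n hn
      simp only [Finset.mem_filter, Finset.mem_range] at hn
      omega
  have htot := Finset.card_filter_add_card_filter_not (s := Finset.range M) R
  rw [Finset.card_range] at htot
  change Nat.card {n : ℕ | ¬ R n} = _
  rw [hset, ← hM]
  rw [Nat.card_coe_set_eq, Set.ncard_coe_finset]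
  omega
end

section
/- Let p, q > 1 be coprime integers. For every m ≥ 1 the Sylvester sum σ_{m−1}(p,q) satisfies m·σ_{m−1}(p,q) = (1/(m+1))·∑_{i=0}^{m} ∑_{j=0}^{m−i} (m+1)!/(i!·j!·(m+1−i−j)!) · B_i·B_j·p^{m−j}·q^{m−i} − B_m. -/
open PowerSeries in
theorem syl_H_mul (p q : ℕ) (hp : 1 < p) (hpq : Nat.Coprime p q)
    (f : ℕ → ℚ) (hf1 : ∀ n, (∃ x y : ℕ, n = x * p + y * q) → f n = 1)
    (hf0 : ∀ n, (¬∃ x y : ℕ, n = x * p + y * q) → f n = 0) :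
    (PowerSeries.mk f) * (1 - X ^ p) = ∑ y ∈ Finset.range p, ((X : ℚ⟦X⟧) ^ q) ^ y := by
  ext n
  rw [mul_sub, mul_one, map_sub, coeff_mk, coeff_mul_X_pow', map_sum]
  simp only [← pow_mul, coeff_X_pow, coeff_mk]
  by_cases h : ∃ y ∈ Finset.range p, n = q * y
  · obtain ⟨y, hy, rfl⟩ := h
    have hq0 : ∀ b ∈ Finset.range p, q * y = q * b → b = y := by
      intro b hb h
      rcases Nat.eq_zero_or_pos q with h0 | h0
      · subst h0; simp at hpq; omega
      · exact (Nat.eq_of_mul_eq_mul_left h0 h).symm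
    rw [Finset.sum_eq_single_of_mem y hy, hf1 _ ⟨0, y, by ring⟩, if_pos rfl]
    · split_ifs with hle
      · rw [hf0, sub_zero]
        rintro ⟨x', y', h⟩
        have h2 : q * y = (x' + 1) * p + y' * q := by
          rw [add_mul, one_mul]; omega
        have h3 : y' < y := by
          by_contra hc
          push Not at hc
          have := Nat.mul_le_mul_right q hc
          nlinarith
        have h4 : p ∣ q * (y - y') := by
          refine ⟨x' + 1, ?_⟩
          rw [Nat.mul_sub, h2, mul_comm y' q, mul_comm p]; omega
        have h5 := Nat.le_of_dvd (by omega) (hpq.dvd_of_dvd_mul_left h4)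
        simp at hy; omega
      · simp
    · intro b hb hby
      rw [if_neg]
      intro h; exact hby (hq0 b hb h)
  · rw [Finset.sum_eq_zero]
    · by_cases hS : ∃ x y : ℕ, n = x * p + y * q
      · obtain ⟨x, y, hxy⟩ := hS
        have h2 : ∃ x' y' : ℕ, n = (x' + 1) * p + y' * q := by
          rcases x with _ | x
          · rcases lt_or_ge y p with hlt | hge
            · exact absurd ⟨y, by simpa using hlt, by rw [hxy]; ring⟩ h
            · obtain ⟨d, rfl⟩ := Nat.exists_eq_add_of_le hge
              rcases q with _ | q
              · simp at hpq; omega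
              · exact ⟨q, d, by rw [hxy]; ring⟩
          · exact ⟨x, y, hxy⟩
        obtain ⟨x', y', h3⟩ := h2
        have hle : p ≤ n := by rw [h3]; nlinarith [Nat.zero_le (x' * p), Nat.zero_le (y' * q)]
        rw [if_pos hle, hf1 n ⟨_, _, hxy⟩, hf1 (n - p), sub_self]
        refine ⟨x', y', ?_⟩
        rw [h3, add_mul, one_mul]; omega
      · rw [hf0 n hS]
        split_ifs with hle
        · rw [hf0, sub_self]
          rintro ⟨x', y', h⟩
          exact hS ⟨x' + 1, y', by rw [add_mul, one_mul]; omega⟩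
        · simp
    · intro y hy
      rw [if_neg]
      intro h'; exact h ⟨y, hy, h'⟩

theorem syl_poly (p q : ℕ) (hp : 1 < p) (hpq : Nat.Coprime p q)
    (hfin : Set.Finite {n : ℕ | ¬∃ x y : ℕ, n = x * p + y * q}) :
    (∑ s ∈ hfin.toFinset, (Polynomial.X : Polynomial ℚ) ^ s) *
      ((1 - Polynomial.X) * ((1 - Polynomial.X ^ p) * (1 - Polynomial.X ^ q))) =
      (1 - Polynomial.X ^ p) * (1 - Polynomial.X ^ q) -
        (1 - Polynomial.X) * (1 - Polynomial.X ^ (p * q)) := by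
  classical
  apply Polynomial.coe_injective ℚ
  let f : ℕ → ℚ := fun n => if ∃ x y : ℕ, n = x * p + y * q then 1 else 0
  have hH := syl_H_mul p q hp hpq f (fun n h => if_pos h) (fun n h => if_neg h)
  have hG : ((∑ s ∈ hfin.toFinset, (Polynomial.X : Polynomial ℚ) ^ s : Polynomial ℚ) :
      PowerSeries ℚ) = PowerSeries.mk 1 - PowerSeries.mk f := by
    ext n
    rw [Polynomial.coeff_coe, Polynomial.finset_sum_coeff]
    simp only [Polynomial.coeff_X_pow, Finset.sum_ite_eq, map_sub, PowerSeries.coeff_mk, f,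
      Set.Finite.mem_toFinset, Set.mem_setOf_eq, Pi.one_apply]
    by_cases h : ∃ x y : ℕ, n = x * p + y * q
    · rw [if_pos h, if_neg (not_not.mpr h), sub_self]
    · rw [if_neg h, if_pos h, sub_zero]
  have h1 : (PowerSeries.mk 1 : PowerSeries ℚ) * (1 - PowerSeries.X) = 1 :=
    PowerSeries.mk_one_mul_one_sub_eq_one ℚ
  have hgeo := geom_sum_mul_neg ((PowerSeries.X : PowerSeries ℚ) ^ q) p
  rw [← hH, ← pow_mul, mul_comm q p] at hgeo
  rw [Polynomial.coe_mul, hG]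
  simp only [Polynomial.coe_mul, Polynomial.coe_sub, Polynomial.coe_one, Polynomial.coe_pow,
    Polynomial.coe_X]
  linear_combination ((1 - (PowerSeries.X : PowerSeries ℚ) ^ p) * (1 - PowerSeries.X ^ q)) * h1
    - (1 - PowerSeries.X) * hgeo

open PowerSeries in
theorem syl_series (p q : ℕ) (hp : 1 < p) (hpq : Nat.Coprime p q)
    (hfin : Set.Finite {n : ℕ | ¬∃ x y : ℕ, n = x * p + y * q}) :
    C ((p : ℚ) * q) * (∑ s ∈ hfin.toFinset, rescale (s : ℚ) (exp ℚ)) * X * X =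
      rescale (p : ℚ) (bernoulliPowerSeries ℚ) * (rescale (q : ℚ) (bernoulliPowerSeries ℚ) *
        (rescale ((p * q : ℕ) : ℚ) (exp ℚ) - 1))
      - C ((p : ℚ) * q) * bernoulliPowerSeries ℚ * X := by
  have h := congrArg (Polynomial.aeval (exp ℚ)) (syl_poly p q hp hpq hfin)
  simp only [map_mul, map_sub, map_sum, map_pow, map_one, Polynomial.aeval_X,
    exp_pow_eq_rescale_exp] at h
  have hb := bernoulliPowerSeries_mul_exp_sub_one ℚ
  have hr : ∀ k : ℕ, rescale (k : ℚ) (bernoulliPowerSeries ℚ) * (rescale (k : ℚ) (exp ℚ) - 1)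
      = C (k : ℚ) * X := by
    intro k
    rw [← rescale_X, ← hb, map_mul, map_sub, map_one]
  have hbp := hr p
  have hbq := hr q
  apply mul_right_cancel₀ (X_ne_zero (R := ℚ))
  rw [map_mul]
  generalize (∑ s ∈ hfin.toFinset, rescale (s : ℚ) (exp ℚ)) = G at *
  generalize rescale (p : ℚ) (bernoulliPowerSeries ℚ) = bp at *
  generalize rescale (q : ℚ) (bernoulliPowerSeries ℚ) = bq at *
  generalize rescale ((p * q : ℕ) : ℚ) (exp ℚ) = epq at *
  generalize rescale (p : ℚ) (exp ℚ) = ep at *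
  generalize rescale (q : ℚ) (exp ℚ) = eq at *
  generalize bernoulliPowerSeries ℚ = b at *
  generalize exp ℚ = e at *
  generalize C (p : ℚ) = P at *
  generalize C (q : ℚ) = Q at *
  have e1 : (b * (e - 1)) * (bp * (ep - 1)) * (bq * (eq - 1)) * G =
      (b * (e - 1)) * bp * bq * (epq - 1) - b * (bp * (ep - 1)) * (bq * (eq - 1)) := by
    linear_combination (-(b * bp * bq)) * h
  rw [hb, hbp, hbq] at e1
  linear_combination e1


/-- Rødseth's formula for the Sylvester sums `σ_k(p,q) = ∑_{s ∉ S(p,q)} s^k` of a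
numerical semigroup `S(p,q)` with coprime generators `p, q > 1`: for `m ≥ 1`,
`m σ_{m-1}(p,q) = (1/(m+1)) ∑_{i=0}^m ∑_{j=0}^{m-i} (m+1)!/(i! j! (m+1-i-j)!)
  B_i B_j p^{m-j} q^{m-i} - B_m`,
where `B_n` are the Bernoulli numbers (with `B_1 = -1/2`). -/
theorem sylvester_sum_bernoulli (p q : ℕ) (hp : 1 < p) (hq : 1 < q)
    (hpq : Nat.Coprime p q)
    (hfin : Set.Finite {n : ℕ | ¬∃ x y : ℕ, n = x * p + y * q})
    (m : ℕ) (hm : 1 ≤ m) :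
    (m : ℚ) * ∑ s ∈ hfin.toFinset, (s : ℚ) ^ (m - 1) =
      (1 / ((m : ℚ) + 1)) *
        ∑ i ∈ Finset.range (m + 1), ∑ j ∈ Finset.range (m - i + 1),
          ((Nat.factorial (m + 1) : ℚ) /
              ((Nat.factorial i : ℚ) * (Nat.factorial j : ℚ) *
                (Nat.factorial (m + 1 - i - j) : ℚ))) *
            bernoulli i * bernoulli j * (p : ℚ) ^ (m - j) * (q : ℚ) ^ (m - i)
      - bernoulli m := by
  obtain ⟨k, rfl⟩ : ∃ k, m = k + 1 := ⟨m - 1, by omega⟩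
  have hs := congrArg (PowerSeries.coeff (k + 1 + 1)) (syl_series p q hp hpq hfin)
  have hp0 : (p : ℚ) ≠ 0 := by positivity
  have hq0 : (q : ℚ) ≠ 0 := by positivity
  rw [map_sub, PowerSeries.coeff_succ_mul_X, PowerSeries.coeff_succ_mul_X,
    PowerSeries.coeff_succ_mul_X, PowerSeries.coeff_C_mul, PowerSeries.coeff_C_mul,
    map_sum, PowerSeries.coeff_mul, Finset.Nat.sum_antidiagonal_eq_sum_range_succ_mk,
    Finset.sum_range_succ] at hs
  have hz : PowerSeries.coeff 0 (PowerSeries.rescale ((p * q : ℕ) : ℚ) (PowerSeries.exp ℚ) - 1)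
      = 0 := by
    rw [map_sub, PowerSeries.coeff_rescale, PowerSeries.coeff_exp]; simp
  have hz2 : PowerSeries.coeff 0 (PowerSeries.rescale (q : ℚ) (bernoulliPowerSeries ℚ) *
      (PowerSeries.rescale ((p * q : ℕ) : ℚ) (PowerSeries.exp ℚ) - 1)) = 0 := by
    rw [PowerSeries.coeff_zero_eq_constantCoeff] at hz ⊢
    rw [map_mul, hz, mul_zero]
  simp only [Nat.sub_self] at hs
  rw [hz2, mul_zero, add_zero] at hs
  have hL : ∑ s ∈ hfin.toFinset, PowerSeries.coeff k (PowerSeries.rescale (s : ℚ)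
      (PowerSeries.exp ℚ)) = (∑ s ∈ hfin.toFinset, (s : ℚ) ^ k) / (Nat.factorial k : ℚ) := by
    rw [Finset.sum_div]
    refine Finset.sum_congr rfl fun s _ => ?_
    simp [PowerSeries.coeff_rescale, PowerSeries.coeff_exp, div_eq_mul_inv]
  have hB : PowerSeries.coeff (k + 1) (bernoulliPowerSeries ℚ) =
      bernoulli (k + 1) / (Nat.factorial (k + 1) : ℚ) := by
    simp [bernoulliPowerSeries]
  have hR : ∑ i ∈ Finset.range (k + 1 + 1), PowerSeries.coeff i (PowerSeries.rescale (p : ℚ)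
        (bernoulliPowerSeries ℚ)) * PowerSeries.coeff (k + 1 + 1 - i)
        (PowerSeries.rescale (q : ℚ) (bernoulliPowerSeries ℚ) *
          (PowerSeries.rescale ((p * q : ℕ) : ℚ) (PowerSeries.exp ℚ) - 1)) =
      ((p : ℚ) * q / (Nat.factorial (k + 1 + 1) : ℚ)) *
      ∑ i ∈ Finset.range (k + 1 + 1), ∑ j ∈ Finset.range (k + 1 - i + 1),
          ((Nat.factorial (k + 1 + 1) : ℚ) /
              ((Nat.factorial i : ℚ) * (Nat.factorial j : ℚ) *
                (Nat.factorial (k + 1 + 1 - i - j) : ℚ))) *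
            bernoulli i * bernoulli j * (p : ℚ) ^ (k + 1 - j) * (q : ℚ) ^ (k + 1 - i) := by
    rw [Finset.mul_sum]
    refine Finset.sum_congr rfl fun i hi => ?_
    rw [Finset.mem_range] at hi
    rw [PowerSeries.coeff_mul, Finset.Nat.sum_antidiagonal_eq_sum_range_succ_mk,
      Finset.sum_range_succ]
    simp only [Nat.sub_self]
    rw [hz, mul_zero, add_zero, Finset.mul_sum, Finset.mul_sum,
      show k + 1 + 1 - i = k + 1 - i + 1 by omega]
    refine Finset.sum_congr rfl fun j hj => ?_
    rw [Finset.mem_range] at hj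
    obtain ⟨c, hc⟩ : ∃ c, k + 1 = i + j + c := ⟨k + 1 - i - j, by omega⟩
    rw [show k + 1 - i + 1 - j = c + 1 by omega, show k + 1 - j = i + c by omega,
      show k + 1 - i = j + c by omega, map_sub, PowerSeries.coeff_one, if_neg (by omega)]
    have f1 : (Nat.factorial (k + 1 + 1) : ℚ) ≠ 0 := by positivity
    have f2 : (Nat.factorial (c + 1) : ℚ) ≠ 0 := by positivity
    have f3 : (Nat.factorial i : ℚ) ≠ 0 := by positivity
    have f4 : (Nat.factorial j : ℚ) ≠ 0 := by positivity
    simp only [PowerSeries.coeff_rescale, PowerSeries.coeff_exp, bernoulliPowerSeries,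
      PowerSeries.coeff_mk, Algebra.algebraMap_self, RingHom.id_apply, sub_zero]
    push_cast
    generalize (Nat.factorial (k + 1 + 1) : ℚ) = F1 at *
    generalize (Nat.factorial (c + 1) : ℚ) = F2 at *
    field_simp
    ring
  rw [hL, hB, hR] at hs
  rw [Nat.add_sub_cancel]
  generalize (∑ i ∈ Finset.range (k + 1 + 1), ∑ j ∈ Finset.range (k + 1 - i + 1),
          ((Nat.factorial (k + 1 + 1) : ℚ) /
              ((Nat.factorial i : ℚ) * (Nat.factorial j : ℚ) *
                (Nat.factorial (k + 1 + 1 - i - j) : ℚ))) *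
            bernoulli i * bernoulli j * (p : ℚ) ^ (k + 1 - j) * (q : ℚ) ^ (k + 1 - i)) = T at *
  generalize (∑ s ∈ hfin.toFinset, (s : ℚ) ^ k) = U at *
  rw [Nat.factorial_succ (k + 1), Nat.factorial_succ k] at hs
  have f1 : (Nat.factorial k : ℚ) ≠ 0 := by positivity
  push_cast at hs ⊢
  have g1 : (k : ℚ) + 1 ≠ 0 := by positivity
  have g2 : (k : ℚ) + 1 + 1 ≠ 0 := by positivity
  field_simp at hs ⊢
  linear_combination hs
end

section
/- Let p, q > 1 be coprime integers. For every m ≥ 1 one has m·σ_{m−1}(p,q) = ∑_{r=0}^{m} C(m,r)·p^{m−r−1}·B_{m−r}·q^r·S_r(p) − B_m, where S_r(p) = ∑_{k=0}^{p−1} k^r; equivalently, the Bernoulli number B_m satisfies the recursion B_m = (m/(p^m − 1))·σ_{m−1}(p,q) + (q^m/(p(1 − p^m)))·∑_{r=0}^{m−1} C(m,r)·(p/q)^r·B_r·S_{m−r}(p). -/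
open Polynomial in
lemma aux_mult (p : ℕ) (hp : 0 < p) (m : ℕ) :
    C ((p:ℚ)^m) * ∑ j ∈ Finset.range p, (Polynomial.bernoulli m).comp (C (p:ℚ)⁻¹ * (X + C (j:ℚ)))
      = C (p:ℚ) * Polynomial.bernoulli m := by
  have hp0 : (p:ℚ) ≠ 0 := by positivity
  set G : ℕ → ℚ[X] := fun m => C ((p:ℚ)^m) * ∑ j ∈ Finset.range p,
    (Polynomial.bernoulli m).comp (C (p:ℚ)⁻¹ * (X + C (j:ℚ))) - C (p:ℚ) * Polynomial.bernoulli m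
    with hG
  have hder : derivative (G (m+1)) = C ((m:ℚ)+1) * G m := by
    have hB : derivative (Polynomial.bernoulli (m+1)) = C ((m:ℚ)+1) * Polynomial.bernoulli m := by
      rw [derivative_bernoulli_add_one]; simp
    have hj : ∀ j : ℕ, derivative ((Polynomial.bernoulli (m+1)).comp
        (C (p:ℚ)⁻¹ * (X + C (j:ℚ)))) = C (p:ℚ)⁻¹ * C ((m:ℚ)+1) *
          (Polynomial.bernoulli m).comp (C (p:ℚ)⁻¹ * (X + C (j:ℚ))) := by
      intro j
      have hd : derivative (C (p:ℚ)⁻¹ * (X + C (j:ℚ))) = C (p:ℚ)⁻¹ := by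
        rw [derivative_C_mul, derivative_add, derivative_X, derivative_C, add_zero, mul_one]
      rw [derivative_comp, hB, hd, mul_comp, C_comp, mul_assoc]
    have hC : (C ((p:ℚ)^(m+1)) : ℚ[X]) * C (p:ℚ)⁻¹ = C ((p:ℚ)^m) := by
      rw [← C_mul]
      exact congrArg C (by rw [pow_succ, mul_assoc, mul_inv_cancel₀ hp0, mul_one])
    simp only [hG]
    rw [derivative_sub, derivative_C_mul, derivative_C_mul, derivative_sum, hB]
    simp only [hj]
    rw [← Finset.mul_sum, ← hC]
    generalize (C ((p:ℚ)^(m+1)) : ℚ[X]) = a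
    generalize (C (p:ℚ)⁻¹ : ℚ[X]) = b
    generalize (C ((m:ℚ)+1) : ℚ[X]) = c
    ring
  have hper : ∀ x : ℚ, (G (m+1)).eval (x+1) = (G (m+1)).eval x := by
    intro x
    have hs := Finset.sum_range_sub (fun j : ℕ => (Polynomial.bernoulli (m+1)).eval ((p:ℚ)⁻¹ * (x + j))) p
    have h1 := Polynomial.bernoulli_eval_one_add (m+1) ((p:ℚ)⁻¹ * x)
    have h2 := Polynomial.bernoulli_eval_one_add (m+1) x
    have e1 : (p:ℚ)⁻¹ * (x + p) = 1 + (p:ℚ)⁻¹ * x := by field_simp; ring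
    simp only [Finset.sum_sub_distrib] at hs
    rw [e1, h1] at hs
    simp only [hG, eval_sub, eval_mul, eval_C, eval_finsetSum, eval_comp, eval_add, eval_X]
    rw [add_comm x 1, h2]
    have e2 : ∀ j : ℕ, (p:ℚ)⁻¹ * (1 + x + j) = (p:ℚ)⁻¹ * (x + ((j+1 : ℕ):ℚ)) := by
      intro j; push_cast; ring
    simp only [e2]
    have hs' := eq_add_of_sub_eq hs
    rw [hs']
    simp only [Nat.cast_zero, add_zero, Nat.add_sub_cancel, mul_pow, inv_pow]
    field_simp
    ring
  have hnat : ∀ n : ℕ, (G (m+1)).eval (n:ℚ) = (G (m+1)).eval 0 := by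
    intro n
    induction n with
    | zero => simp
    | succ n ih => rw [Nat.cast_succ, hper, ih]
  have hconst : G (m+1) = C ((G (m+1)).eval 0) := by
    apply Polynomial.eq_of_infinite_eval_eq
    refine Set.Infinite.mono ?_ (Set.infinite_range_of_injective (Nat.cast_injective (R := ℚ)))
    rintro _ ⟨n, rfl⟩
    simp [hnat n]
  have h0 : derivative (G (m+1)) = 0 := by rw [hconst, derivative_C]
  rw [h0] at hder
  have hc : (C ((m:ℚ)+1) : ℚ[X]) ≠ 0 := by
    rw [Ne, C_eq_zero]; positivity
  have := (mul_eq_zero.mp hder.symm).resolve_left hc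
  exact sub_eq_zero.mp this

lemma aux_inj (p q : ℕ) (hpq : Nat.Coprime p q) (k l : ℕ) (hk : k < p) (hl : l < p)
    (h : q * k % p = q * l % p) : k = l := by
  have h1 : q * k ≡ q * l [MOD p] := h
  have h2 := Nat.ModEq.cancel_left_of_coprime hpq h1
  rwa [Nat.ModEq, Nat.mod_eq_of_lt hk, Nat.mod_eq_of_lt hl] at h2

lemma aux_surj (p q : ℕ) (hp : 0 < p) (hpq : Nat.Coprime p q) :
    Set.SurjOn (fun k => q * k % p) (Finset.range p : Set ℕ) (Finset.range p : Set ℕ) := by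
  apply Finset.surjOn_of_injOn_of_card_le
  · intro k _
    simpa using Nat.mod_lt _ hp
  · intro k hk l hl h
    exact aux_inj p q hpq k l (by simpa using hk) (by simpa using hl) h
  · simp

lemma aux_reindex (p q : ℕ) (hp : 0 < p) (hpq : Nat.Coprime p q) (g : ℕ → ℚ) :
    ∑ k ∈ Finset.range p, g (q * k % p) = ∑ j ∈ Finset.range p, g j := by
  refine Finset.sum_nbij (fun k => q * k % p) ?_ ?_ (aux_surj p q hp hpq) (fun _ _ => rfl)
  · intro k _
    simpa using Nat.mod_lt _ hp
  · intro k hk l hl h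
    exact aux_inj p q hpq k l (by simpa using hk) (by simpa using hl) h

lemma aux_gaps (p q : ℕ) (hp : 0 < p) (hpq : Nat.Coprime p q)
    (hfin : Set.Finite {n : ℕ | ¬∃ x y : ℕ, n = x * p + y * q}) (f : ℕ → ℚ) :
    ∑ s ∈ hfin.toFinset, f s =
      ∑ k ∈ Finset.range p, ∑ i ∈ Finset.range (q * k / p), f (q * k % p + p * i) := by
  rw [Finset.sum_sigma']
  symm
  refine Finset.sum_nbij (fun a : (_ : ℕ) × ℕ => q * a.1 % p + p * a.2) ?_ ?_ ?_ (fun _ _ => rfl)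
  · rintro ⟨k, i⟩ h
    simp only [Finset.mem_sigma, Finset.mem_range] at h
    obtain ⟨hk, hi⟩ := h
    simp only [Set.Finite.mem_toFinset, Set.mem_ofPred_eq]
    rintro ⟨x, y, hxy⟩
    have hdm := Nat.mod_add_div (q * k) p
    have hlt : p * i < p * (q * k / p) := Nat.mul_lt_mul_of_pos_left hi hp
    have h1 : q * k % p = q * (y % p) % p := by
      have := congrArg (· % p) hxy
      simp only [Nat.add_mul_mod_self_left, Nat.mod_mod] at this
      rw [this, Nat.mul_mod_mod, mul_comm y q, add_comm, Nat.add_mul_mod_self_right]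
    have h2 := aux_inj p q hpq _ _ hk (Nat.mod_lt _ hp) h1
    have h3 : k ≤ y := h2 ▸ Nat.mod_le y p
    have h4 : q * k ≤ q * y := Nat.mul_le_mul_left q h3
    have h5 : 0 ≤ x * p := Nat.zero_le _
    rw [mul_comm y q] at hxy
    omega
  · rintro ⟨k, i⟩ h ⟨l, j⟩ h' e
    simp only [Finset.coe_sigma, Set.mem_sigma_iff, Finset.coe_range, Set.mem_Iio] at h h'
    have e' : q * k % p + p * i = q * l % p + p * j := e
    have h1 : q * k % p = q * l % p := by
      have := congrArg (· % p) e'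
      simpa only [Nat.add_mul_mod_self_left, Nat.mod_mod] using this
    have h2 := aux_inj p q hpq _ _ h.1 h'.1 h1
    subst h2
    have : i = j := Nat.eq_of_mul_eq_mul_left hp (by omega)
    rw [this]
  · intro s hs
    simp only [Set.Finite.coe_toFinset, Set.mem_ofPred_eq] at hs
    obtain ⟨k, hk, hks⟩ := aux_surj p q hp hpq
      (show s % p ∈ (Finset.range p : Set ℕ) by simpa using Nat.mod_lt _ hp)
    have hks' : q * k % p = s % p := hks
    have d1 := Nat.mod_add_div (q * k) p
    have d2 := Nat.mod_add_div s p
    refine ⟨⟨k, s / p⟩, ?_, ?_⟩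
    · simp only [Finset.coe_sigma, Set.mem_sigma_iff, Finset.coe_range, Set.mem_Iio]
      refine ⟨by simpa using hk, ?_⟩
      by_contra hlt
      push Not at hlt
      apply hs
      refine ⟨s / p - q * k / p, k, ?_⟩
      obtain ⟨d, hd⟩ := Nat.exists_eq_add_of_le hlt
      rw [hd, Nat.add_sub_cancel_left]
      rw [hd, mul_add] at d2
      rw [mul_comm d p, mul_comm k q]
      omega
    · simp only [hks']
      exact d2

lemma aux_shift (m t : ℕ) (x : ℚ) :
    (Polynomial.bernoulli m).eval (x + t) = (Polynomial.bernoulli m).eval x +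
      m * ∑ i ∈ Finset.range t, (x + i) ^ (m - 1) := by
  induction t with
  | zero => simp
  | succ t ih =>
    have := Polynomial.bernoulli_eval_one_add m (x + t)
    rw [Finset.sum_range_succ, Nat.cast_succ, show x + ((t:ℚ) + 1) = 1 + (x + t) by ring, this, ih]
    ring

lemma aux_first (p q : ℕ) (hp : 1 < p) (hpq : Nat.Coprime p q)
    (hfin : Set.Finite {n : ℕ | ¬∃ x y : ℕ, n = x * p + y * q})
    (m : ℕ) (hm : 1 ≤ m) :
    (m : ℚ) * ∑ s ∈ hfin.toFinset, (s : ℚ) ^ (m - 1) =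
      (∑ r ∈ Finset.range (m + 1),
        (Nat.choose m r : ℚ) * (p : ℚ) ^ ((m : ℤ) - r - 1) * bernoulli (m - r) *
          (q : ℚ) ^ r * ∑ k ∈ Finset.range p, (k : ℚ) ^ r)
      - bernoulli m := by
  have hp0 : (p:ℚ) ≠ 0 := by positivity
  obtain ⟨n, rfl⟩ : ∃ n, m = n + 1 := ⟨m - 1, by omega⟩
  have key : ∀ k : ℕ, (p:ℚ)^n * (Polynomial.bernoulli (n+1)).eval ((q:ℚ) * k / p) =
      (p:ℚ)^n * (Polynomial.bernoulli (n+1)).eval ((p:ℚ)⁻¹ * ((q * k % p : ℕ):ℚ)) +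
      ((n+1 : ℕ):ℚ) * ∑ i ∈ Finset.range (q * k / p), ((q * k % p + p * i : ℕ) : ℚ) ^ n := by
    intro k
    have d : (((q * k % p + p * (q * k / p) : ℕ)) : ℚ) = ((q * k : ℕ) : ℚ) := by
      rw [Nat.mod_add_div]
    have e : (q:ℚ) * k / p = (p:ℚ)⁻¹ * ((q * k % p : ℕ):ℚ) + ((q * k / p : ℕ) : ℚ) := by
      rw [Nat.cast_add, Nat.cast_mul p, Nat.cast_mul q] at d
      rw [← d]; field_simp
    rw [e, aux_shift, mul_add, mul_left_comm, Finset.mul_sum (Finset.range _) _ ((p:ℚ)^n),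
      Nat.add_sub_cancel]
    congr 2
    refine Finset.sum_congr rfl fun i _ => ?_
    rw [← mul_pow]
    congr 1
    rw [Nat.cast_add, Nat.cast_mul p]
    field_simp
  have hsum := Finset.sum_congr (rfl : Finset.range p = Finset.range p) (fun k _ => key k)
  rw [Finset.sum_add_distrib, ← Finset.mul_sum, ← Finset.mul_sum, ← Finset.mul_sum,
    ← aux_gaps p q (by omega) hpq hfin (fun s => (s:ℚ)^n),
    aux_reindex p q (by omega) hpq
      (fun j => (Polynomial.bernoulli (n+1)).eval ((p:ℚ)⁻¹ * (j:ℚ)))] at hsum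
  have hmul := congrArg (Polynomial.eval 0) (aux_mult p (by omega) (n+1))
  simp only [Polynomial.eval_mul, Polynomial.eval_C, Polynomial.eval_finsetSum,
    Polynomial.eval_comp, Polynomial.eval_add, Polynomial.eval_X, zero_add,
    Polynomial.bernoulli_eval_zero] at hmul
  have hmul' : (p:ℚ)^n * ∑ j ∈ Finset.range p,
      (Polynomial.bernoulli (n+1)).eval ((p:ℚ)⁻¹ * (j:ℚ)) = bernoulli (n+1) := by
    apply mul_left_cancel₀ hp0
    rw [← hmul]; ring
  rw [hmul'] at hsum
  rw [Nat.add_sub_cancel]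
  rw [eq_sub_iff_add_eq, add_comm, ← hsum, Finset.mul_sum]
  simp only [Finset.mul_sum (Finset.range p)]
  rw [Finset.sum_comm]
  refine Finset.sum_congr rfl fun k _ => ?_
  rw [Polynomial.bernoulli_def]
  simp only [Polynomial.eval_finsetSum, Polynomial.eval_monomial, Finset.mul_sum]
  refine Finset.sum_congr rfl fun r hr => ?_
  have e3 : (p:ℚ) ^ (((n + 1 : ℕ):ℤ) - r - 1) = (p:ℚ)^n / (p:ℚ)^r := by
    rw [show ((n + 1 : ℕ):ℤ) - r - 1 = (n:ℤ) - (r:ℤ) by push_cast; ring, zpow_sub₀ hp0]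
    simp
  rw [e3, div_pow, mul_pow]
  ring


/-- For coprime `p, q > 1` and `m ≥ 1`, with `σ_k(p,q) = ∑_{s ∉ S(p,q)} s^k` the Sylvester
sums, `S_r(n) = ∑_{k=0}^{n-1} k^r` the power sums and `B_n` the Bernoulli numbers
(`B_1 = -1/2`), one has
`m σ_{m-1}(p,q) = ∑_{r=0}^m C(m,r) p^{m-r-1} B_{m-r} q^r S_r(p) - B_m`,
and equivalently the Bernoulli recursion
`B_m = (m/(p^m-1)) σ_{m-1}(p,q) + (q^m/(p(1-p^m))) ∑_{r=0}^{m-1} C(m,r) (p/q)^r B_r S_{m-r}(p)`. -/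
theorem sylvester_sum_power_sum_bernoulli_recursion (p q : ℕ) (hp : 1 < p) (hq : 1 < q)
    (hpq : Nat.Coprime p q)
    (hfin : Set.Finite {n : ℕ | ¬∃ x y : ℕ, n = x * p + y * q})
    (m : ℕ) (hm : 1 ≤ m) :
    (m : ℚ) * ∑ s ∈ hfin.toFinset, (s : ℚ) ^ (m - 1) =
      (∑ r ∈ Finset.range (m + 1),
        (Nat.choose m r : ℚ) * (p : ℚ) ^ ((m : ℤ) - r - 1) * bernoulli (m - r) *
          (q : ℚ) ^ r * ∑ k ∈ Finset.range p, (k : ℚ) ^ r)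
      - bernoulli m ∧
    bernoulli m =
      ((m : ℚ) / ((p : ℚ) ^ m - 1)) * ∑ s ∈ hfin.toFinset, (s : ℚ) ^ (m - 1) +
      ((q : ℚ) ^ m / ((p : ℚ) * (1 - (p : ℚ) ^ m))) *
        ∑ r ∈ Finset.range m,
          (Nat.choose m r : ℚ) * ((p : ℚ) / (q : ℚ)) ^ r * bernoulli r *
            ∑ k ∈ Finset.range p, (k : ℚ) ^ (m - r) := by
  have h1 := aux_first p q hp hpq hfin m hm
  refine ⟨h1, ?_⟩
  have hp0 : (p:ℚ) ≠ 0 := by positivity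
  have hq0 : (q:ℚ) ≠ 0 := by positivity
  have hpm : (1:ℚ) < (p:ℚ) ^ m := one_lt_pow₀ (by exact_mod_cast hp) (by omega)
  have hne : (p:ℚ) ^ m - 1 ≠ 0 := by linarith
  have hne' : 1 - (p:ℚ) ^ m ≠ 0 := by linarith
  rw [← Finset.sum_range_reflect, Finset.sum_range_succ] at h1
  have h2 : ∑ r ∈ Finset.range m, (Nat.choose m (m + 1 - 1 - r) : ℚ) *
      (p : ℚ) ^ ((m : ℤ) - (m + 1 - 1 - r : ℕ) - 1) * bernoulli (m - (m + 1 - 1 - r)) *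
          (q : ℚ) ^ (m + 1 - 1 - r) * ∑ k ∈ Finset.range p, (k : ℚ) ^ (m + 1 - 1 - r) =
      (q:ℚ)^m / p * ∑ r ∈ Finset.range m,
          (Nat.choose m r : ℚ) * ((p : ℚ) / (q : ℚ)) ^ r * bernoulli r *
            ∑ k ∈ Finset.range p, (k : ℚ) ^ (m - r) := by
    rw [Finset.mul_sum]
    refine Finset.sum_congr rfl fun r hr => ?_
    have hr' : r < m := by simpa using hr
    have e1 : m + 1 - 1 - r = m - r := by omega
    have e2 : m - (m - r) = r := by omega
    have e3 : (m : ℤ) - (m - r : ℕ) - 1 = (r:ℤ) - 1 := by omega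
    rw [e1, e2, e3, Nat.choose_symm hr'.le, zpow_sub₀ hp0, zpow_natCast, zpow_one, div_pow,
      pow_sub₀ _ hq0 hr'.le]
    ring
  rw [h2] at h1
  have e4 : (m : ℤ) - (m + 1 - 1 - m : ℕ) - 1 = (m:ℤ) - 1 := by omega
  have e5 : m + 1 - 1 - m = 0 := by omega
  rw [e4, e5, zpow_sub₀ hp0, zpow_natCast, zpow_one] at h1
  simp only [Nat.choose_zero_right, Nat.cast_one, one_mul, Nat.sub_zero, pow_zero, mul_one,
    Finset.sum_const, Finset.card_range, nsmul_eq_mul] at h1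
  rw [div_mul_eq_mul_div, h1, show (p:ℚ) * (1 - (p:ℚ)^m) = -(p * ((p:ℚ)^m - 1)) by ring]
  field_simp
  ring
end

section
/- Let p, q > 1 be coprime integers. Then σ_1(p,q) = (1/12)·(p−1)(q−1)(2pq − p − q − 1) and σ_2(p,q) = (1/12)·(p−1)(q−1)·pq·(pq − p − q). -/
theorem gap_set_eq (p q : ℕ) (hp : 1 < p) (hq : 1 < q) (hpq : Nat.Coprime p q) (G : Finset ℕ)
    (hG : ∀ n, n ∈ G ↔ ¬∃ x y : ℕ, n = x * p + y * q) :
    G ∪ (Finset.range p).image (fun j => j * q) = G.image (fun s => s + p) ∪ Finset.range p := by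
  ext n
  simp only [Finset.mem_union, Finset.mem_image, Finset.mem_range]
  constructor
  · rintro (h | ⟨j, hj, rfl⟩)
    · by_cases hn : n < p
      · exact Or.inr hn
      · left
        refine ⟨n - p, ?_, by omega⟩
        rw [hG] at h ⊢
        rintro ⟨x, y, hxy⟩
        exact h ⟨x + 1, y, by rw [add_mul]; omega⟩
    · by_cases hn : j * q < p
      · exact Or.inr hn
      · left
        refine ⟨j * q - p, ?_, by omega⟩
        rw [hG]
        rintro ⟨x, y, hxy⟩
        have h1 : j * q = (x + 1) * p + y * q := by rw [add_mul]; omega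
        have hyj : y < j := by
          by_contra hc
          have : j * q ≤ y * q := Nat.mul_le_mul_right _ (by omega)
          have : 0 < (x + 1) * p := by positivity
          omega
        have h2 : (j - y) * q = (x + 1) * p := by rw [Nat.sub_mul]; omega
        have h3 : p ∣ j - y := hpq.dvd_of_dvd_mul_right ⟨x + 1, by rw [h2, mul_comm]⟩
        have := Nat.le_of_dvd (by omega) h3
        omega
  · rintro (⟨s, hs, rfl⟩ | h)
    · by_cases hn : s + p ∈ G
      · exact Or.inl hn
      · right
        rw [hG, not_not] at hn
        rw [hG] at hs
        obtain ⟨x, y, hxy⟩ := hn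
        rcases x with _ | x
        · refine ⟨y, ?_, by omega⟩
          by_contra hc
          obtain ⟨d, rfl⟩ := Nat.exists_eq_add_of_le (not_lt.mp hc)
          obtain ⟨e, rfl⟩ := Nat.exists_eq_add_of_le hq.le
          exact hs ⟨e, d, by nlinarith⟩
        · exact absurd ⟨x, y, by rw [add_mul] at hxy; omega⟩ hs
    · by_cases hn : n ∈ G
      · exact Or.inl hn
      · right
        rw [hG, not_not] at hn
        obtain ⟨x, y, hxy⟩ := hn
        rcases x with _ | x
        · refine ⟨y, ?_, by omega⟩
          nlinarith
        · rw [add_mul] at hxy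
          have := Nat.zero_le (x * p)
          have := Nat.zero_le (y * q)
          omega

theorem gap_sum_eq (p q : ℕ) (hp : 1 < p) (hq : 1 < q) (hpq : Nat.Coprime p q) (G : Finset ℕ)
    (hG : ∀ n, n ∈ G ↔ ¬∃ x y : ℕ, n = x * p + y * q) (f : ℕ → ℚ) :
    ∑ s ∈ G, f s + ∑ j ∈ Finset.range p, f (j * q) =
      ∑ s ∈ G, f (s + p) + ∑ r ∈ Finset.range p, f r := by
  have h := congrArg (fun A => ∑ s ∈ A, f s) (gap_set_eq p q hp hq hpq G hG)
  rw [Finset.sum_union, Finset.sum_union, Finset.sum_image, Finset.sum_image] at h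
  · exact h
  · intro a _ b _ hab
    simpa using hab
  · intro a _ b _ hab
    exact Nat.eq_of_mul_eq_mul_right (by omega) hab
  · rw [Finset.disjoint_left]
    intro a ha hb
    simp only [Finset.mem_image, Finset.mem_range] at ha hb
    obtain ⟨s, _, rfl⟩ := ha
    omega
  · rw [Finset.disjoint_left]
    intro a ha hb
    simp only [Finset.mem_image] at hb
    obtain ⟨j, _, rfl⟩ := hb
    exact (hG _).1 ha ⟨0, j, by simp⟩

theorem pow_sums (p : ℕ) :
    ∑ j ∈ Finset.range p, (j : ℚ) = p * (p - 1) / 2 ∧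
    ∑ j ∈ Finset.range p, (j : ℚ) ^ 2 = p * (p - 1) * (2 * p - 1) / 6 ∧
    ∑ j ∈ Finset.range p, (j : ℚ) ^ 3 = (p * (p - 1) / 2) ^ 2 := by
  induction p with
  | zero => simp
  | succ n ih =>
    obtain ⟨h1, h2, h3⟩ := ih
    simp only [Finset.sum_range_succ, h1, h2, h3]
    push_cast
    refine ⟨?_, ?_, ?_⟩ <;> ring

/-- Brown–Shiue: for coprime `p, q > 1`, the Sylvester sums
`σ_k(p,q) = ∑_{s ∉ S(p,q)} s^k` satisfy
`σ_1(p,q) = (1/12)(p-1)(q-1)(2pq-p-q-1)` and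
`σ_2(p,q) = (1/12)(p-1)(q-1)pq(pq-p-q)`. -/
theorem sylvester_sums_one_two (p q : ℕ) (hp : 1 < p) (hq : 1 < q)
    (hpq : Nat.Coprime p q)
    (hfin : Set.Finite {n : ℕ | ¬∃ x y : ℕ, n = x * p + y * q}) :
    (∑ s ∈ hfin.toFinset, (s : ℚ) ^ 1) =
      (1 / 12) * ((p : ℚ) - 1) * ((q : ℚ) - 1) *
        (2 * (p : ℚ) * (q : ℚ) - (p : ℚ) - (q : ℚ) - 1) ∧
    (∑ s ∈ hfin.toFinset, (s : ℚ) ^ 2) =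
      (1 / 12) * ((p : ℚ) - 1) * ((q : ℚ) - 1) * (p : ℚ) * (q : ℚ) *
        ((p : ℚ) * (q : ℚ) - (p : ℚ) - (q : ℚ)) := by
  have hG : ∀ n, n ∈ hfin.toFinset ↔ ¬∃ x y : ℕ, n = x * p + y * q := fun n => by simp
  generalize hfin.toFinset = G at hG ⊢
  have key := gap_sum_eq p q hp hq hpq G hG
  obtain ⟨a1, a2, a3⟩ := pow_sums p
  have k1 := key (fun n => (n : ℚ))
  have k2 := key (fun n => (n : ℚ) ^ 2)
  have k3 := key (fun n => (n : ℚ) ^ 3)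
  have e2 : ∀ s : ℕ, ((s : ℚ) + p) ^ 2 = (s : ℚ) ^ 2 + 2 * p * s + p ^ 2 := fun s => by ring
  have e3 : ∀ s : ℕ, ((s : ℚ) + p) ^ 3 =
      (s : ℚ) ^ 3 + 3 * p * (s : ℚ) ^ 2 + 3 * p ^ 2 * s + p ^ 3 := fun s => by ring
  simp only [Nat.cast_add, Nat.cast_mul, e2, e3, mul_pow, Finset.sum_add_distrib,
    ← Finset.mul_sum, ← Finset.sum_mul, Finset.sum_const, nsmul_eq_mul, a1, a2, a3] at k1 k2 k3
  simp only [pow_one]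
  have hp0 : (p : ℚ) ≠ 0 := by positivity
  generalize ∑ s ∈ G, (s : ℚ) = A at *
  generalize ∑ s ∈ G, (s : ℚ) ^ 2 = B at *
  generalize ∑ s ∈ G, (s : ℚ) ^ 3 = C at *
  generalize (G.card : ℚ) = N at *
  have hN : N = (p - 1) * (q - 1) / 2 := by
    apply mul_left_cancel₀ hp0
    linear_combination -k1
  subst hN
  have hA : A = (1 / 12) * ((p : ℚ) - 1) * ((q : ℚ) - 1) *
        (2 * (p : ℚ) * (q : ℚ) - (p : ℚ) - (q : ℚ) - 1) := by
    apply mul_left_cancel₀ hp0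
    linear_combination -k2 / 2
  subst hA
  refine ⟨rfl, ?_⟩
  apply mul_left_cancel₀ hp0
  linear_combination -k3 / 3
end

section
/- If p, q > 1 are coprime integers, then the maximum gap of the binary inclusion–exclusion polynomial satisfies g(Q_{p,q}) = min{p, q} − 1. -/
open Polynomial

def SG (p q n : ℕ) : Prop := ∃ a b : ℕ, n = a * p + b * q

lemma SG_add {p q n : ℕ} (h : SG p q n) : SG p q (n + p) := by
  obtain ⟨a, b, rfl⟩ := h
  exact ⟨a + 1, b, by ring⟩

lemma SG_mul (p q a : ℕ) : SG p q (p * a) := ⟨a, 0, by ring⟩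

lemma SG_small {p q n : ℕ} (hpq : p < q) (h0 : 0 < n) (hn : n < p) : ¬ SG p q n := by
  rintro ⟨a, b, h⟩
  rcases Nat.eq_zero_or_pos a with rfl | ha
  · rcases Nat.eq_zero_or_pos b with rfl | hb
    · omega
    · nlinarith
  · nlinarith

lemma SG_apery1 {p q j : ℕ} (hpq : Nat.Coprime p q) (hj : j < p) (m : ℕ) (h : j * q = m + p) :
    ¬ SG p q m := by
  rintro ⟨a, b, rfl⟩
  have hq : 0 < q := by
    rcases Nat.eq_zero_or_pos q with rfl | h'
    · simp at h; omega
    · exact h'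
  have hbj : b < j := by
    by_contra hc
    have : j * q ≤ b * q := Nat.mul_le_mul_right _ (by omega)
    omega
  obtain ⟨d, rfl⟩ := Nat.exists_eq_add_of_lt hbj
  have h2 : (d + 1) * q = (a + 1) * p := by nlinarith
  have h3 : p ∣ (d + 1) * q := ⟨a + 1, by rw [h2]; ring⟩
  have h4 := Nat.le_of_dvd (by omega) (hpq.dvd_of_dvd_mul_right h3)
  omega

lemma SG_apery2 {p q n : ℕ} (hp : 0 < p) (hn : SG p q n) (h : ¬ ∃ j < p, n = j * q) :
    ∃ m, n = m + p ∧ SG p q m := by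
  obtain ⟨a, b, rfl⟩ := hn
  have hb := Nat.div_add_mod b p
  have hlt := Nat.mod_lt b hp
  have e : a * p + b * q = (a + b / p * q) * p + (b % p) * q := by
    conv_lhs => rw [← hb]
    ring
  rcases Nat.eq_zero_or_pos (a + b / p * q) with h0 | h0
  · exact absurd ⟨b % p, hlt, by rw [e, h0]; ring⟩ h
  · obtain ⟨t, ht⟩ := Nat.exists_eq_succ_of_ne_zero h0.ne'
    exact ⟨t * p + (b % p) * q, by rw [e, ht, Nat.succ_eq_add_one]; ring, t, _, rfl⟩

open Classical in
noncomputable def HS (p q : ℕ) : PowerSeries ℤ := PowerSeries.mk fun n => if SG p q n then 1 else 0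

lemma HS_mul (p q : ℕ) (hp : 1 < p) (hq : 1 < q) (hpq : Nat.Coprime p q) :
    HS p q * (PowerSeries.X ^ p - 1) =
      -((∑ j ∈ Finset.range p, (X ^ q) ^ j : ℤ[X]) : PowerSeries ℤ) := by
  classical
  ext n
  rw [mul_sub, mul_one, map_sub, map_neg, PowerSeries.coeff_mul_X_pow', Polynomial.coeff_coe,
    Polynomial.finsetSum_coeff]
  simp only [← pow_mul, Polynomial.coeff_X_pow, HS, PowerSeries.coeff_mk]
  by_cases h : ∃ j < p, n = j * q
  · obtain ⟨j, hj, rfl⟩ := h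
    have h1 : SG p q (j * q) := ⟨0, j, by ring⟩
    rw [Finset.sum_eq_single_of_mem j (by simpa using hj)]
    · rw [if_pos h1, if_pos (mul_comm j q)]
      split_ifs with h2 h3
      · exact absurd h3 (SG_apery1 hpq hj _ (by omega))
      · simp
      · simp
    · intro b _ hb
      rw [if_neg]
      intro he
      apply hb
      have : q * b = q * j := by rw [← he]; ring
      exact Nat.eq_of_mul_eq_mul_left (by omega) this
  · rw [Finset.sum_eq_zero]
    · by_cases hn : SG p q n
      · obtain ⟨m, rfl, hm⟩ := SG_apery2 (by omega) hn h
        simp [hn, hm]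
      · rw [if_neg hn]
        split_ifs with h2 h3
        · exfalso; apply hn
          have := SG_add h3
          rwa [Nat.sub_add_cancel h2] at this
        · simp
        · simp
    · intro b hb
      rw [if_neg]
      rintro rfl
      exact h ⟨b, by simpa using hb, by ring⟩

lemma Q_eq (p q : ℕ) (hp : 1 < p) (hq : 1 < q)
    (hpq : Nat.Coprime p q) (Q : Polynomial ℤ)
    (hQ : Q * ((Polynomial.X ^ p - 1) * (Polynomial.X ^ q - 1)) =
      (Polynomial.X ^ (p * q) - 1) * (Polynomial.X - 1)) :
    (Q : PowerSeries ℤ) = HS p q * (1 - PowerSeries.X) := by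
  have hne : ∀ k : ℕ, 1 < k → (X ^ k - 1 : ℤ[X]) ≠ 0 := fun k hk => by
    simpa using Polynomial.X_pow_sub_C_ne_zero (by omega : 0 < k) (1 : ℤ)
  have h1 : Q * (X ^ p - 1) = (∑ j ∈ Finset.range p, (X ^ q) ^ j : ℤ[X]) * (X - 1) := by
    apply mul_right_cancel₀ (hne q hq)
    have := geom_sum_mul (X ^ q : ℤ[X]) p
    rw [← pow_mul, mul_comm q p] at this
    rw [mul_assoc, hQ, ← this]; ring
  have h2 := congrArg (fun f : ℤ[X] => (f : PowerSeries ℤ)) h1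
  simp only [Polynomial.coe_mul] at h2
  have e1 : ((X ^ p - 1 : ℤ[X]) : PowerSeries ℤ) = PowerSeries.X ^ p - 1 := by
    simp
  have e2 : ((X - 1 : ℤ[X]) : PowerSeries ℤ) = PowerSeries.X - 1 := by
    simp
  have hne' : (PowerSeries.X ^ p - 1 : PowerSeries ℤ) ≠ 0 := by
    rw [← e1]
    intro h
    exact hne p hp (Polynomial.coe_eq_zero_iff.mp h)
  apply mul_right_cancel₀ hne'
  have h3 := HS_mul p q hp hq hpq
  rw [← e1, h2, e1, e2]
  linear_combination (PowerSeries.X - 1) * h3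

lemma mem_supp_s15 (p q : ℕ) (hp : 1 < p) (hq : 1 < q)
    (hpq : Nat.Coprime p q) (Q : Polynomial ℤ)
    (hQ : Q * ((Polynomial.X ^ p - 1) * (Polynomial.X ^ q - 1)) =
      (Polynomial.X ^ (p * q) - 1) * (Polynomial.X - 1)) (n : ℕ) :
    n + 1 ∈ Q.support ↔ ¬ (SG p q (n + 1) ↔ SG p q n) := by
  classical
  have h := congrArg (PowerSeries.coeff (n + 1)) (Q_eq p q hp hq hpq Q hQ)
  rw [mul_sub, mul_one, map_sub, PowerSeries.coeff_succ_mul_X, Polynomial.coeff_coe] at h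
  simp only [HS, PowerSeries.coeff_mk] at h
  rw [Polynomial.mem_support_iff, h]
  by_cases h1 : SG p q (n + 1) <;> by_cases h2 : SG p q n <;> simp [h1, h2]

lemma main_lt (p q : ℕ) (hp : 1 < p) (hlt : p < q)
    (hpq : Nat.Coprime p q) (Q : Polynomial ℤ)
    (hQ : Q * ((Polynomial.X ^ p - 1) * (Polynomial.X ^ q - 1)) =
      (Polynomial.X ^ (p * q) - 1) * (Polynomial.X - 1)) :
    maxGap Q = p - 1 := by
  have hS := mem_supp_s15 p q hp (by omega) hpq Q hQ
  apply le_antisymm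
  · unfold maxGap
    apply Finset.sup_le
    rintro ⟨e, e'⟩ hmem
    obtain ⟨-, he'⟩ := Finset.mem_product.mp hmem
    simp only at he' ⊢
    split_ifs with h
    swap
    · omega
    obtain ⟨hl, hc⟩ := h
    by_contra hcon
    have hconst : ∀ k, e + k < e' → (SG p q (e + k) ↔ SG p q e) := by
      intro k
      induction k with
      | zero => simp
      | succ k ih =>
        intro hk
        rw [← ih (by omega)]
        by_contra hne
        have := hc _ ((hS (e + k)).2 hne)
        omega
    have hm : SG p q e := by
      have h1 := Nat.div_add_mod (e + p - 1) p
      have h2 := Nat.mod_lt (e + p - 1) (by omega : 0 < p)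
      set m := p * ((e + p - 1) / p) with hmdef
      have h3 := hconst (m - e) (by omega)
      rw [show e + (m - e) = m by omega] at h3
      exact h3.1 (SG_mul p q _)
    have hall : ∀ k, SG p q (e + k) := by
      intro k
      induction k using Nat.strong_induction_on with
      | _ k ih =>
        by_cases hk : k < p
        · exact (hconst k (by omega)).2 hm
        · have := SG_add (ih (k - p) (by omega))
          rwa [show e + (k - p) + p = e + k by omega] at this
    have a1 := hall (e' - e)
    have a2 := hall (e' - 1 - e)
    rw [show e + (e' - e) = e' - 1 + 1 by omega] at a1
    rw [show e + (e' - 1 - e) = e' - 1 by omega] at a2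
    rw [show e' = e' - 1 + 1 by omega] at he'
    exact (hS _).1 he' (iff_of_true a1 a2)
  · have m0 : SG p q 0 := ⟨0, 0, by simp⟩
    have mp : SG p q (p - 1 + 1) := ⟨1, 0, by omega⟩
    have m1 : 1 ∈ Q.support := (hS 0).2 fun h =>
      SG_small hlt (by omega) (by omega) (h.2 m0)
    have mp' : p ∈ Q.support := by
      have := (hS (p - 1)).2 fun h => SG_small hlt (by omega) (by omega) (h.1 mp)
      rwa [show p - 1 + 1 = p by omega] at this
    unfold maxGap
    refine le_trans ?_ (Finset.le_sup (b := (1, p)) (Finset.mem_product.mpr ⟨m1, mp'⟩))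
    simp only
    rw [if_pos]
    refine ⟨hp, fun c hc => ?_⟩
    by_contra hcon
    rw [show c = c - 1 + 1 by omega] at hc
    exact (hS _).1 hc (iff_of_false (SG_small hlt (by omega) (by omega))
      (SG_small hlt (by omega) (by omega)))

/-- For coprime `p, q > 1`, the maximum gap of the binary inclusion–exclusion polynomial
`Q_{p,q}(x) = (x^{pq}-1)(x-1)/((x^p-1)(x^q-1))` equals `min{p,q} - 1`. -/
theorem maxGap_binary_inclusion_exclusion (p q : ℕ) (hp : 1 < p) (hq : 1 < q)
    (hpq : Nat.Coprime p q) (Q : Polynomial ℤ)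
    (hQ : Q * ((Polynomial.X ^ p - 1) * (Polynomial.X ^ q - 1)) =
      (Polynomial.X ^ (p * q) - 1) * (Polynomial.X - 1)) :
    maxGap Q = min p q - 1 := by
  rcases lt_trichotomy p q with h | h | h
  · rw [min_eq_left h.le]
    exact main_lt p q hp h hpq Q hQ
  · subst h
    rw [Nat.coprime_self] at hpq
    omega
  · rw [min_eq_right h.le]
    exact main_lt q p hq h hpq.symm Q (by rw [mul_comm q p, ← hQ]; ring)
end

section
/- Let S be a numerical semigroup with multiplicity m(S). Then: (1) the longest gap block of S has length exactly m(S) − 1; (2) the longest element block of S has length at most m(S) − 1; and (3) if S is symmetric, the longest element block has length exactly m(S) − 1. -/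
/-- For a numerical semigroup `S` with multiplicity `m` (smallest positive element) and
Frobenius number `F`:
(1) the longest block of consecutive gaps of `S` has length exactly `m - 1`;
(2) every finite block of consecutive elements of `S` (one followed by a gap) has length
at most `m - 1`;
(3) if `S` is symmetric (`S ∪ (F - S) = ℤ`), then there is a finite block of consecutive
elements of `S` of length exactly `m - 1`. -/
theorem gap_blocks_and_element_blocks (S : Set ℕ) (h0 : 0 ∈ S)
    (hadd : ∀ a ∈ S, ∀ b ∈ S, a + b ∈ S) (hfin : Sᶜ.Finite)
    (m : ℕ) (hmS : m ∈ S) (hmpos : 0 < m) (hmin : ∀ n ∈ S, 0 < n → m ≤ n)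
    (F : ℕ) (hF : F ∉ S) (hF' : ∀ n, F < n → n ∈ S) :
    ((∃ k : ℕ, ∀ i < m - 1, k + i ∉ S) ∧
      ∀ k L : ℕ, (∀ i < L, k + i ∉ S) → L ≤ m - 1) ∧
    (∀ k L : ℕ, (∀ i < L, k + i ∈ S) → k + L ∉ S → L ≤ m - 1) ∧
    ((∀ z : ℤ, (∃ s ∈ S, (s : ℤ) = z) ∨ (∃ s ∈ S, (F : ℤ) - s = z)) →
      ∃ k : ℕ, (∀ i < m - 1, k + i ∈ S) ∧ k + (m - 1) ∉ S) := by
  refine ⟨⟨⟨1, ?_⟩, ?_⟩, ?_, ?_⟩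
  · intro i hi h
    have := hmin _ h (by omega)
    omega
  · intro k L h
    by_contra hL
    have hmul : ∀ q : ℕ, m * q ∈ S := by
      intro q
      induction q with
      | zero => simpa using h0
      | succ q ih => rw [Nat.mul_succ]; exact hadd _ ih _ hmS
    have h1 := Nat.div_add_mod (k + (m - 1)) m
    have h2 := Nat.mod_lt (k + (m - 1)) hmpos
    have h3 := hmul ((k + (m - 1)) / m)
    generalize m * ((k + (m - 1)) / m) = t at *
    apply h (t - k) (by omega)
    rwa [show k + (t - k) = t by omega]
  · intro k L h hn
    by_contra hL
    apply hn
    have := hadd _ (h (L - m) (by omega)) _ hmS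
    rwa [show k + (L - m) + m = k + L by omega] at this
  · intro hsym
    have hFm : m - 1 ≤ F := by
      by_contra hlt
      have h1 := hF' (m - 1) (by omega)
      have := hmin _ h1 (by omega)
      omega
    refine ⟨F - (m - 1), ?_, ?_⟩
    · intro i hi
      rcases hsym ((F - (m - 1) + i : ℕ) : ℤ) with ⟨s, hs, e⟩ | ⟨s, hs, e⟩
      · have : s = F - (m - 1) + i := by exact_mod_cast e
        rwa [← this]
      · have := hmin s hs (by omega)
        omega
    · rwa [show F - (m - 1) + (m - 1) = F by omega]
end

section
/- Let S be a numerical semigroup with multiplicity m(S). Then the maximum gap of the semigroup polynomial satisfies g(P_S) = m(S) − 1. -/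
open Polynomial

lemma supp_iff_aux (S : Set ℕ) (h0 : 0 ∈ S) (P : Polynomial ℤ)
    (hP : (P : PowerSeries ℤ) = (1 - PowerSeries.X) * hilbertSeries S) :
    0 ∈ P.support ∧ ∀ n, (n + 1 ∈ P.support ↔ ¬ (n + 1 ∈ S ↔ n ∈ S)) := by
  classical
  have hc : ∀ n, P.coeff n = PowerSeries.coeff n ((1 - PowerSeries.X) * hilbertSeries S) := by
    intro n
    rw [← hP, Polynomial.coeff_coe]
  constructor
  · rw [Polynomial.mem_support_iff, hc, sub_mul, one_mul, map_sub,
      PowerSeries.coeff_zero_X_mul]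
    simp [hilbertSeries, h0]
  · intro n
    rw [Polynomial.mem_support_iff, hc, sub_mul, one_mul, map_sub,
      PowerSeries.coeff_succ_X_mul]
    by_cases h1 : n + 1 ∈ S <;> by_cases h2 : n ∈ S <;>
      simp [hilbertSeries, h1, h2]

theorem maxGap_semigroup_polynomial (S : Set ℕ) (h0 : 0 ∈ S)
    (hadd : ∀ a ∈ S, ∀ b ∈ S, a + b ∈ S) (hfin : Sᶜ.Finite)
    (m : ℕ) (hmS : m ∈ S) (hmpos : 0 < m) (hmin : ∀ n ∈ S, 0 < n → m ≤ n)
    (P : Polynomial ℤ)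
    (hP : (P : PowerSeries ℤ) = (1 - PowerSeries.X) * hilbertSeries S) :
    maxGap P = m - 1 := by
  obtain ⟨hs0, hs⟩ := supp_iff_aux S h0 P hP
  have hmul : ∀ k, m * k ∈ S := by
    intro k
    induction k with
    | zero => simpa using h0
    | succ k ih => rw [Nat.mul_succ]; exact hadd _ ih _ hmS
  apply le_antisymm
  · unfold maxGap
    apply Finset.sup_le
    rintro ⟨a, b⟩ hab
    rw [Finset.mem_product] at hab
    obtain ⟨ha, hb⟩ := hab
    dsimp only at ha hb ⊢
    split_ifs with h
    swap
    · exact Nat.zero_le _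
    obtain ⟨hlt, hcons⟩ := h
    have hconst : ∀ k, a + k < b → (a + k ∈ S ↔ a ∈ S) := by
      intro k
      induction k with
      | zero => intro _; rfl
      | succ k ih =>
        intro hk
        have h1 := ih (by omega)
        have h2 : a + k + 1 ∉ P.support := by
          intro hc
          have := hcons _ hc
          omega
        rw [hs, not_not] at h2
        exact h2.trans h1
    by_contra hgt
    have hbm : a + m ≤ b := by omega
    by_cases haS : a ∈ S
    · have hb1 : b - 1 + 1 ∈ P.support := by
        rwa [Nat.sub_add_cancel (by omega)]
      rw [hs, Nat.sub_add_cancel (by omega)] at hb1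
      have e1 := hconst (b - 1 - a) (by omega)
      rw [show a + (b - 1 - a) = b - 1 by omega] at e1
      have e2 := hconst (b - m - a) (by omega)
      rw [show a + (b - m - a) = b - m by omega] at e2
      have e3 := hadd _ (e2.2 haS) _ hmS
      rw [show b - m + m = b by omega] at e3
      exact hb1 ⟨fun _ => e1.2 haS, fun _ => e3⟩
    · have hd := Nat.div_add_mod (a + m - 1) m
      have hl := Nat.mod_lt (a + m - 1) hmpos
      have e1 := hconst (m * ((a + m - 1) / m) - a) (by omega)
      rw [show a + (m * ((a + m - 1) / m) - a) = m * ((a + m - 1) / m) by omega] at e1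
      exact haS (e1.1 (hmul _))
  · by_cases hm1 : m = 1
    · subst hm1; exact Nat.zero_le _
    have hnot : ∀ n, 0 < n → n < m → n ∉ S := fun n h1 h2 h3 => by
      have := hmin n h3 h1
      omega
    have h1 : 1 ∈ P.support := (hs 0).2 fun h => hnot 1 (by omega) (by omega) (h.2 h0)
    have hm : m ∈ P.support := by
      have := (hs (m - 1)).2
      rw [Nat.sub_add_cancel hmpos] at this
      exact this fun h => hnot (m - 1) (by omega) (by omega) (h.1 hmS)
    have hle := Finset.le_sup (f := fun e : ℕ × ℕ =>
      if e.1 < e.2 ∧ ∀ c ∈ P.support, c ≤ e.1 ∨ e.2 ≤ c then e.2 - e.1 else 0)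
      (Finset.mk_mem_product h1 hm)
    have hcond : (1 : ℕ) < m ∧ ∀ c ∈ P.support, c ≤ 1 ∨ m ≤ c := by
      refine ⟨by omega, fun c hc => ?_⟩
      by_contra hcc
      obtain ⟨d, rfl⟩ : ∃ d, c = d + 1 := ⟨c - 1, by omega⟩
      refine (hs d).1 hc ⟨fun h => ?_, fun h => ?_⟩
      · exact absurd h (hnot _ (by omega) (by omega))
      · exact absurd h (hnot _ (by omega) (by omega))
    dsimp only at hle
    rw [if_pos hcond] at hle
    exact hle
end

section
/- Let p, q > 1 be coprime integers. The coefficient a_{p,q}(k) of x^k in Q_{p,q}(x) equals 1 if k ∈ S(p,q) and k − 1 ∉ S(p,q); it equals −1 if k ∉ S(p,q) and k − 1 ∈ S(p,q); and it equals 0 otherwise. Consequently, the nonzero coefficients of Q_{p,q}(x), read in order of increasing exponent, alternate between 1 and −1, beginning and ending with 1. -/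
open Polynomial

def InS (p q k : ℕ) : Prop := ∃ x y : ℕ, k = x * p + y * q

open scoped Classical in
noncomputable def indS (p q k : ℕ) : ℤ := if InS p q k then 1 else 0

lemma indS_cases (p q k : ℕ) : (InS p q k ∧ indS p q k = 1) ∨ (¬ InS p q k ∧ indS p q k = 0) := by
  unfold indS
  by_cases h : InS p q k <;> simp [h]

lemma indS_step (p q : ℕ) (hp : 1 < p) (hq : 1 < q) (hpq : Nat.Coprime p q) (k : ℕ) :
    indS p q k - (if p ≤ k then indS p q (k - p) else 0)
      = ∑ i ∈ Finset.range p, if k = q * i then (1 : ℤ) else 0 := by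
  by_cases h : ∃ i, i < p ∧ k = q * i
  · obtain ⟨i, hi, rfl⟩ := h
    have h1 : InS p q (q * i) := ⟨0, i, by ring⟩
    have h2 : p ≤ q * i → ¬ InS p q (q * i - p) := by
      rintro hle ⟨x, y, hxy⟩
      have e : q * i = (x + 1) * p + y * q := by
        have : (x + 1) * p = x * p + p := by ring
        omega
      have hyi : y < i := by
        by_contra hc
        have : q * i ≤ q * y := Nat.mul_le_mul_left _ (by omega)
        nlinarith
      obtain ⟨d, rfl⟩ := Nat.exists_eq_add_of_lt hyi
      have e2 : q * (d + 1) = p * (x + 1) := by linarith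
      have : p ∣ d + 1 := hpq.dvd_of_dvd_mul_left ⟨x + 1, e2⟩
      have := Nat.le_of_dvd (by omega) this
      omega
    have h3 : (∑ j ∈ Finset.range p, if q * i = q * j then (1 : ℤ) else 0) = 1 := by
      rw [Finset.sum_eq_single i]
      · simp
      · intro j _ hj
        rw [if_neg]
        intro hh
        exact hj (Nat.eq_of_mul_eq_mul_left (by omega) hh).symm
      · intro hh
        exact absurd (Finset.mem_range.2 hi) hh
    rw [h3]
    split_ifs with hle
    · simp [indS, h1, h2 hle]
    · simp [indS, h1]
  · have h3 : (∑ j ∈ Finset.range p, if k = q * j then (1 : ℤ) else 0) = 0 := by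
      apply Finset.sum_eq_zero
      intro j hj
      rw [if_neg]
      intro hh
      exact h ⟨j, Finset.mem_range.1 hj, hh⟩
    rw [h3]
    have h4 : InS p q k → p ≤ k ∧ InS p q (k - p) := by
      rintro ⟨x, y, rfl⟩
      rcases x with _ | x
      · have hy : p ≤ y := by
          by_contra hc
          exact h ⟨y, by omega, by ring⟩
        obtain ⟨z, rfl⟩ := Nat.exists_eq_add_of_le hy
        obtain ⟨r, rfl⟩ := Nat.exists_eq_add_of_lt hq
        have e : 0 * p + (p + z) * (1 + r + 1) = ((1 + r) * p + z * (1 + r + 1)) + p := by ring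
        rw [e]
        exact ⟨by omega, 1 + r, z, by omega⟩
      · have e : (x + 1) * p + y * q = (x * p + y * q) + p := by ring
        rw [e]
        exact ⟨by omega, x, y, by omega⟩
    have h5 : p ≤ k → InS p q (k - p) → InS p q k := by
      rintro hle ⟨x, y, hxy⟩
      refine ⟨x + 1, y, ?_⟩
      have : (x + 1) * p = x * p + p := by ring
      omega
    by_cases hk : InS p q k
    · obtain ⟨a, b⟩ := h4 hk
      simp [indS, hk, a, b]
    · split_ifs with hle
      · have : ¬ InS p q (k - p) := fun t => hk (h5 hle t)
        simp [indS, hk, this]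
      · simp [indS, hk]

lemma series_id (p q : ℕ) (hp : 1 < p) (hq : 1 < q) (hpq : Nat.Coprime p q) :
    PowerSeries.mk (indS p q) * (1 - PowerSeries.X ^ p) * (1 - PowerSeries.X ^ q)
      = 1 - PowerSeries.X ^ (p * q) := by
  have h1 : PowerSeries.mk (indS p q) * (1 - PowerSeries.X ^ p)
      = ∑ i ∈ Finset.range p, ((PowerSeries.X : PowerSeries ℤ) ^ q) ^ i := by
    ext k
    rw [mul_sub, mul_one, map_sub, map_sum, PowerSeries.coeff_mul_X_pow', PowerSeries.coeff_mk,
      PowerSeries.coeff_mk, indS_step p q hp hq hpq]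
    apply Finset.sum_congr rfl
    intro i _
    rw [← pow_mul, PowerSeries.coeff_X_pow]
  rw [h1]
  have := geom_sum_mul ((PowerSeries.X : PowerSeries ℤ) ^ q) p
  rw [← pow_mul, mul_comm q p] at this
  linear_combination -this

lemma Q_series (p q : ℕ) (hp : 1 < p) (hq : 1 < q) (hpq : Nat.Coprime p q) (Q : Polynomial ℤ)
    (hQ : Q * ((Polynomial.X ^ p - 1) * (Polynomial.X ^ q - 1)) =
      (Polynomial.X ^ (p * q) - 1) * (Polynomial.X - 1)) :
    (Q : PowerSeries ℤ) = PowerSeries.mk (indS p q) * (1 - PowerSeries.X) := by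
  have h := congrArg (Polynomial.coeToPowerSeries.ringHom (R := ℤ)) hQ
  simp only [map_mul, map_sub, map_pow, map_one,
    Polynomial.coeToPowerSeries.ringHom_apply, Polynomial.coe_X] at h
  have nz : ∀ n : ℕ, 1 < n → ((PowerSeries.X : PowerSeries ℤ) ^ n - 1) ≠ 0 := by
    intro n hn h0
    have := congrArg (PowerSeries.coeff 0) h0
    rw [map_sub, PowerSeries.coeff_X_pow] at this
    simp [show 0 ≠ n by omega] at this
  apply mul_right_cancel₀ (mul_ne_zero (nz p hp) (nz q hq))
  rw [h]
  linear_combination (PowerSeries.X - 1) * series_id p q hp hq hpq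

lemma Q_coeff (p q : ℕ) (hp : 1 < p) (hq : 1 < q) (hpq : Nat.Coprime p q) (Q : Polynomial ℤ)
    (hQ : Q * ((Polynomial.X ^ p - 1) * (Polynomial.X ^ q - 1)) =
      (Polynomial.X ^ (p * q) - 1) * (Polynomial.X - 1)) (k : ℕ) :
    Q.coeff k = indS p q k - (if 1 ≤ k then indS p q (k - 1) else 0) := by
  rw [← Polynomial.coeff_coe, Q_series p q hp hq hpq Q hQ, mul_sub, mul_one, map_sub]
  have := PowerSeries.coeff_mul_X_pow' (PowerSeries.mk (indS p q)) 1 k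
  rw [pow_one] at this
  rw [this, PowerSeries.coeff_mk, PowerSeries.coeff_mk]



open scoped Classical in
/-- For coprime `p, q > 1`, the coefficient of `x^k` in the binary inclusion–exclusion
polynomial `Q_{p,q}(x) = (x^{pq}-1)(x-1)/((x^p-1)(x^q-1))` is `1` if `k ∈ S(p,q)` and
`k - 1 ∉ S(p,q)`, `-1` if `k ∉ S(p,q)` and `k - 1 ∈ S(p,q)`, and `0` otherwise (with the
convention that negative integers are not in `S(p,q)`). Consequently the nonzero
coefficients of `Q_{p,q}`, in order of increasing exponent, alternate between `1` and `-1`,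
beginning and ending with `1`. -/
theorem coeff_binary_via_semigroup (p q : ℕ) (hp : 1 < p) (hq : 1 < q)
    (hpq : Nat.Coprime p q) (Q : Polynomial ℤ)
    (hQ : Q * ((Polynomial.X ^ p - 1) * (Polynomial.X ^ q - 1)) =
      (Polynomial.X ^ (p * q) - 1) * (Polynomial.X - 1)) :
    (∀ k : ℕ,
      Q.coeff k =
        if (∃ x y : ℕ, k = x * p + y * q) ∧
            ¬(1 ≤ k ∧ ∃ x y : ℕ, k - 1 = x * p + y * q) then 1
        else if ¬(∃ x y : ℕ, k = x * p + y * q) ∧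
            (1 ≤ k ∧ ∃ x y : ℕ, k - 1 = x * p + y * q) then -1
        else 0) ∧
    (∀ a b : ℕ, a < b → Q.coeff a ≠ 0 → Q.coeff b ≠ 0 →
      (∀ c : ℕ, a < c → c < b → Q.coeff c = 0) → Q.coeff b = -Q.coeff a) ∧
    Q.coeff 0 = 1 ∧ Q.coeff Q.natDegree = 1 := by
  have hc := Q_coeff p q hp hq hpq Q hQ
  have hs : ∀ k, Q.coeff (k + 1) = indS p q (k + 1) - indS p q k := by
    intro k
    rw [hc]
    simp
  have h0 : indS p q 0 = 1 := by
    have : InS p q 0 := ⟨0, 0, by simp⟩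
    simp [indS, this]
  have hc0 : Q.coeff 0 = 1 := by
    rw [hc]
    simp [h0]
  have const : ∀ a d : ℕ, (∀ c, a < c → c ≤ a + d → Q.coeff c = 0) →
      indS p q (a + d) = indS p q a := by
    intro a d
    induction d with
    | zero => intro _; rfl
    | succ d ih =>
      intro h
      have h1 := ih (fun c h1 h2 => h c h1 (by omega))
      have h2 := h (a + d + 1) (by omega) (by omega)
      rw [hs] at h2
      rw [← add_assoc]
      linarith
  have pos : ∀ k, Q.coeff k ≠ 0 → Q.coeff k = 2 * indS p q k - 1 := by
    intro k hk
    rcases k with _ | k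
    · rw [hc0, h0]; norm_num
    · rw [hs] at hk ⊢
      rcases indS_cases p q k with ⟨_, h1⟩ | ⟨_, h1⟩ <;>
      rcases indS_cases p q (k + 1) with ⟨_, h2⟩ | ⟨_, h2⟩ <;>
      omega
  refine ⟨?_, ?_, hc0, ?_⟩
  · intro k
    change Q.coeff k = if InS p q k ∧ ¬(1 ≤ k ∧ InS p q (k - 1)) then 1
        else if ¬ InS p q k ∧ (1 ≤ k ∧ InS p q (k - 1)) then -1 else 0
    rw [hc]
    unfold indS
    by_cases h1 : InS p q k <;> by_cases h2 : 1 ≤ k <;> by_cases h3 : InS p q (k - 1) <;>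
      simp [h1, h2, h3]
  · intro a b hab ha hb h
    obtain ⟨d, rfl⟩ := Nat.exists_eq_add_of_lt hab
    have h1 := const a d (fun c h1 h2 => h c h1 (by omega))
    have h2 := pos a ha
    have h3 := pos _ hb
    have h4 := hs (a + d)
    linarith
  · have hne : Q ≠ 0 := by
      rintro rfl
      simp at hc0
    have hl : Q.coeff Q.natDegree ≠ 0 := by
      simpa using hne
    have h1 := const Q.natDegree (Q.natDegree * (p - 1))
      (fun c h1 _ => Polynomial.coeff_eq_zero_of_natDegree_lt h1)
    have h2 : InS p q (Q.natDegree + Q.natDegree * (p - 1)) := by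
      refine ⟨Q.natDegree, 0, ?_⟩
      obtain ⟨r, rfl⟩ := Nat.exists_eq_add_of_lt hp
      simp
      ring
    have h3 : indS p q (Q.natDegree + Q.natDegree * (p - 1)) = 1 := by
      simp [indS, h2]
    have h4 := pos _ hl
    linarith
end

section
/- Let p, q > 1 be coprime integers and let ρ, σ be the unique nonnegative integers with 1 + pq = ρp + σq. Then the numerical semigroup S(p,q) has exactly ρσ − 1 gap blocks and exactly ρσ − 1 element blocks. -/
theorem aux_notin (p q : ℕ) (hq : 0 < q) (h : Nat.Coprime p q) (x y : ℤ) (hx : x < q)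
    (hy : y < 0) (a b : ℕ) : x * p + y * q ≠ a * p + b * q := by
  intro e
  have hd : (q : ℤ) ∣ (x - a) * p := ⟨b - y, by linarith⟩
  have hc : IsCoprime (q : ℤ) (p : ℤ) := (Nat.isCoprime_iff_coprime.mpr h).symm
  obtain ⟨t, ht⟩ := hc.dvd_of_dvd_mul_right hd
  have hq' : (0 : ℤ) < q := by exact_mod_cast hq
  have e2 : (q : ℤ) * (t * p) = q * (b - y) := by
    have : (x - a) * (p : ℤ) = q * t * p := by rw [ht]
    linarith
  have e3 := mul_left_cancel₀ hq'.ne' e2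
  have ht0 : 0 < t := by
    by_contra hn
    have : t * (p : ℤ) ≤ 0 := mul_nonpos_of_nonpos_of_nonneg (by linarith) (by positivity)
    have : (0 : ℤ) ≤ b := by positivity
    linarith
  have : (q : ℤ) ≤ q * t := by nlinarith
  have : (0 : ℤ) ≤ a := by positivity
  linarith

theorem aux_inj_s19 (p q : ℕ) (hq : 0 < q) (h : Nat.Coprime p q) (x y x' y' : ℕ) (hx : x < q)
    (hx' : x' < q) (e : x * p + y * q = x' * p + y' * q) : x = x' ∧ y = y' := by
  have e' : (x : ℤ) * p + y * q = x' * p + y' * q := by exact_mod_cast e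
  have hy : y = y' := by
    rcases lt_trichotomy y y' with hl | hl | hl
    · exact (aux_notin p q hq h x (y - y' : ℤ) (by exact_mod_cast hx) (by omega) x' 0
        (by push_cast; linarith)).elim
    · exact hl
    · exact (aux_notin p q hq h x' (y' - y : ℤ) (by exact_mod_cast hx') (by omega) x 0
        (by push_cast; linarith)).elim
  subst hy
  have hx1 : x = x' := by
    by_contra hne
    have hp : p = 0 := by
      have : x * p = x' * p := by omega
      rcases mul_eq_mul_right_iff.mp this with h1 | h1
      · exact absurd h1 hne
      · exact h1
    subst hp
    have : q = 1 := by simpa using h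
    omega
  exact ⟨hx1, rfl⟩

theorem aux_big (p q : ℕ) (hq : 0 < q) (h : Nat.Coprime p q) (j : ℕ)
    (hj : p * q < j + p + q) : ∃ x y : ℕ, j = x * p + y * q := by
  have hc : IsCoprime (p : ℤ) (q : ℤ) := Nat.isCoprime_iff_coprime.mpr h
  obtain ⟨u, v, huv⟩ := hc
  have hq' : (0 : ℤ) < q := by exact_mod_cast hq
  have h0 := Int.emod_nonneg (u * j) hq'.ne'
  have h1 := Int.emod_lt_of_pos (u * j) hq'
  have h2 := Int.emod_add_mul_ediv (u * j) q
  obtain ⟨x, hx⟩ := Int.eq_ofNat_of_zero_le h0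
  rw [hx] at h1 h2
  set t := u * j / (q : ℤ)
  have e : (j : ℤ) = x * p + (v * j + t * p) * q := by
    have : (j : ℤ) = (u * j) * p + v * j * q := by linear_combination -(j : ℤ) * huv
    linear_combination this - (p : ℤ) * h2
  have hy : 0 ≤ v * j + t * p := by
    by_contra hn
    have h3 : v * j + t * p ≤ -1 := by omega
    have h4 : (v * j + t * p) * q ≤ -1 * q := mul_le_mul_of_nonneg_right h3 hq'.le
    have h5 : (x : ℤ) * p ≤ (q - 1) * p := mul_le_mul_of_nonneg_right (by omega) (by positivity)
    have h6 : (p : ℤ) * q < j + p + q := by exact_mod_cast hj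
    linarith
  obtain ⟨y, hy⟩ := Int.eq_ofNat_of_zero_le hy
  rw [hy] at e
  exact ⟨x, y, by exact_mod_cast e⟩

/-- For coprime `p, q > 1` with `ρ, σ` the nonnegative integers satisfying
`1 + pq = ρp + σq`, the numerical semigroup `S(p,q)` has exactly `ρσ - 1` gap blocks
(maximal blocks of consecutive gaps, counted by their starting points) and exactly
`ρσ - 1` element blocks (maximal finite blocks of consecutive elements, counted by their
starting points). -/
theorem count_gap_blocks_and_element_blocks (p q : ℕ) (hp : 1 < p) (hq : 1 < q)
    (hpq : Nat.Coprime p q) (ρ σ : ℕ) (hρσ : 1 + p * q = ρ * p + σ * q) :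
    Nat.card {k : ℕ | ¬(∃ x y : ℕ, k = x * p + y * q) ∧
        (∃ x y : ℕ, k - 1 = x * p + y * q)} = ρ * σ - 1 ∧
    Nat.card {k : ℕ | (∃ x y : ℕ, k = x * p + y * q) ∧
        (k = 0 ∨ ¬∃ x y : ℕ, k - 1 = x * p + y * q) ∧
        ∃ j : ℕ, k < j ∧ ¬∃ x y : ℕ, j = x * p + y * q} = ρ * σ - 1 := by
  have hσ0 : 0 < σ := by
    rcases Nat.eq_zero_or_pos σ with h | h
    · subst h
      have h1 : p ∣ 1 := (Nat.dvd_add_left (dvd_mul_right p q)).mp ⟨ρ, by rw [hρσ]; ring⟩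
      have := Nat.dvd_one.mp h1
      omega
    · exact h
  have hρ0 : 0 < ρ := by
    rcases Nat.eq_zero_or_pos ρ with h | h
    · subst h
      have h1 : q ∣ 1 := (Nat.dvd_add_left (dvd_mul_left q p)).mp ⟨σ, by rw [hρσ]; ring⟩
      have := Nat.dvd_one.mp h1
      omega
    · exact h
  have hρq : ρ < q := by
    by_contra hn
    have h1 : q * p ≤ ρ * p := Nat.mul_le_mul_right _ (by omega)
    have h2 : 1 * q ≤ σ * q := Nat.mul_le_mul_right _ hσ0
    nlinarith
  have hσp : σ < p := by
    by_contra hn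
    have h1 : p * q ≤ σ * q := Nat.mul_le_mul_right _ (by omega)
    have h2 : 1 * p ≤ ρ * p := Nat.mul_le_mul_right _ hρ0
    nlinarith
  obtain ⟨c, hc⟩ := Nat.exists_eq_add_of_lt hρq
  obtain ⟨d, hd⟩ := Nat.exists_eq_add_of_lt hσp
  have hc : q = ρ + (c + 1) := by omega
  have hd : p = σ + (d + 1) := by omega
  generalize c + 1 = c at hc
  generalize d + 1 = d at hd
  have hZ : (1 : ℤ) + p * q = ρ * p + σ * q := by exact_mod_cast hρσ
  have hcZ : (q : ℤ) = ρ + c := by exact_mod_cast hc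
  have hdZ : (p : ℤ) = σ + d := by exact_mod_cast hd
  have hA : (ρ : ℤ) * p = 1 + d * q := by linear_combination (-hZ) + (q : ℤ) * hdZ
  have hB : (σ : ℤ) * q = 1 + c * p := by linear_combination (-hZ) + (p : ℤ) * hcZ
  have hcard : c * d = ρ * σ - 1 := by
    have : (c : ℤ) * d + 1 = ρ * σ := by
      linear_combination (-hA) + (ρ : ℤ) * hdZ - (d : ℤ) * hcZ
    have : c * d + 1 = ρ * σ := by exact_mod_cast this
    omega
  have hq0 : 0 < q := by omega
  constructor
  · have hs : {k : ℕ | ¬(∃ x y : ℕ, k = x * p + y * q) ∧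
        (∃ x y : ℕ, k - 1 = x * p + y * q)} =
        (((Finset.range c ×ˢ Finset.range d).image (fun z => z.1 * p + z.2 * q + 1) : Finset ℕ) :
          Set ℕ) := by
      ext k
      simp only [Set.mem_setOf_eq, Finset.coe_image, Set.mem_image, Finset.mem_coe,
        Finset.mem_product, Finset.mem_range, Prod.exists]
      constructor
      · rintro ⟨hk, x, y, e⟩
        have hk0 : k ≠ 0 := fun h => hk ⟨0, 0, by simp [h]⟩
        have e1 : k = x * p + y * q + 1 := by omega
        refine ⟨x, y, ⟨?_, ?_⟩, e1.symm⟩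
        · by_contra hn
          refine hk ⟨x - c, y + σ, ?_⟩
          zify [Nat.le_of_not_lt hn]
          rw [e1]; push_cast
          linear_combination -hB
        · by_contra hn
          refine hk ⟨x + ρ, y - d, ?_⟩
          zify [Nat.le_of_not_lt hn]
          rw [e1]; push_cast
          linear_combination -hA
      · rintro ⟨x, y, ⟨hx, hy⟩, rfl⟩
        refine ⟨?_, x, y, by omega⟩
        rintro ⟨a, b, e⟩
        have e' : (x : ℤ) * p + y * q + 1 = a * p + b * q := by exact_mod_cast e
        exact aux_notin p q hq0 hpq (x + ρ) (y - d) (by omega) (by omega) a b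
          (by linear_combination e' + hA)
    rw [hs, Nat.card_coe_set_eq, Set.ncard_coe_finset, Finset.card_image_of_injOn]
    · simpa using hcard
    · rintro ⟨x, y⟩ h1 ⟨x', y'⟩ h2 e
      simp only [Finset.coe_product, Set.mem_prod, Finset.mem_coe, Finset.mem_range] at h1 h2 e
      obtain ⟨h3, h4⟩ := aux_inj_s19 p q hq0 hpq x y x' y' (by omega) (by omega) (by omega)
      rw [h3, h4]
  · have hs : {k : ℕ | (∃ x y : ℕ, k = x * p + y * q) ∧
        (k = 0 ∨ ¬∃ x y : ℕ, k - 1 = x * p + y * q) ∧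
        ∃ j : ℕ, k < j ∧ ¬∃ x y : ℕ, j = x * p + y * q} =
        ((((Finset.range ρ ×ˢ Finset.range σ).erase (ρ - 1, σ - 1)).image
          (fun z => z.1 * p + z.2 * q) : Finset ℕ) : Set ℕ) := by
      ext k
      simp only [Set.mem_setOf_eq, Finset.coe_image, Set.mem_image, Finset.mem_coe,
        Finset.mem_erase, Finset.mem_product, Finset.mem_range, Prod.exists, ne_eq, Prod.mk.injEq]
      constructor
      · rintro ⟨⟨x, y, e⟩, hk, j, hkj, hj⟩
        refine ⟨x, y, ⟨?_, ?_⟩, e.symm⟩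
        · rintro ⟨rfl, rfl⟩
          apply hj
          apply aux_big p q hq0 hpq
          have e' : (k : ℤ) = (ρ - 1) * p + (σ - 1) * q := by
            rw [e]; push_cast [Nat.cast_sub hρ0, Nat.cast_sub hσ0]; rfl
          zify at hkj ⊢
          linarith
        · by_cases hk0 : k = 0
          · have h1 : x * p = 0 := by omega
            have h2 : y * q = 0 := by omega
            rcases Nat.mul_eq_zero.mp h1 with h3 | h3 <;> rcases Nat.mul_eq_zero.mp h2 with h4 | h4 <;> omega
          · have hk := hk.resolve_left hk0
            have hk1 : 1 ≤ k := by omega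
            constructor
            · by_contra hn
              refine hk ⟨x - ρ, y + d, ?_⟩
              zify [Nat.le_of_not_lt hn, hk1]
              rw [e]; push_cast
              linear_combination hA
            · by_contra hn
              refine hk ⟨x + c, y - σ, ?_⟩
              zify [Nat.le_of_not_lt hn, hk1]
              rw [e]; push_cast
              linear_combination hB
      · rintro ⟨x, y, ⟨hne, hx, hy⟩, rfl⟩
        refine ⟨⟨x, y, rfl⟩, ?_, p * q - p - q, ?_, ?_⟩
        · by_cases hk0 : x * p + y * q = 0
          · exact Or.inl hk0
          · right
            rintro ⟨a, b, e⟩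
            have e1 : x * p + y * q = a * p + b * q + 1 := by omega
            have e' : (x : ℤ) * p + y * q = a * p + b * q + 1 := by exact_mod_cast e1
            exact aux_notin p q hq0 hpq (x + c) (y - σ) (by omega) (by omega) a b
              (by linear_combination e' - hB)
        · have : x + 2 ≤ ρ ∧ y + 1 ≤ σ ∨ x + 1 ≤ ρ ∧ y + 2 ≤ σ := by omega
          have h3 : x * p + y * q + p + q + 1 ≤ p * q := by
            rcases this with ⟨h1, h2⟩ | ⟨h1, h2⟩
            · have := Nat.mul_le_mul_right p h1
              have := Nat.mul_le_mul_right q h2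
              linarith
            · have := Nat.mul_le_mul_right p h1
              have := Nat.mul_le_mul_right q h2
              linarith
          omega
        · rintro ⟨a, b, e⟩
          have h3 : p + q ≤ p * q := by nlinarith
          have e1 : p * q = a * p + b * q + p + q := by omega
          have e' : (p : ℤ) * q = a * p + b * q + p + q := by exact_mod_cast e1
          exact aux_notin p q hq0 hpq (q - 1) (-1) (by omega) (by omega) a b
            (by linear_combination e')
    rw [hs, Nat.card_coe_set_eq, Set.ncard_coe_finset, Finset.card_image_of_injOn]
    · rw [Finset.card_erase_of_mem]
      · simp
      · simp [hρ0, hσ0]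
    · rintro ⟨x, y⟩ h1 ⟨x', y'⟩ h2 e
      simp only [Finset.mem_coe, Finset.mem_erase, Finset.mem_product, Finset.mem_range] at h1 h2 e
      obtain ⟨h3, h4⟩ := aux_inj_s19 p q hq0 hpq x y x' y' (by omega) (by omega) (by omega)
      rw [h3, h4]
end
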